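/- arXiv:2006.04032 — 3 statements merged into one kernel-verified Lean document; each statement's English description precedes it below -/
import Mathlib

section
/- Let p : S² → ℝP² be the canonical quotient map sending a unit vector x to the line through x (the two-fold covering of the real projective plane by the sphere). Let f : ℝP² → ℝP² be a continuous map such that the induced homomorphism on fundamental groups (at some basepoint b, from π₁(ℝP², b) to π₁(ℝP², f(b))) is an isomorphism, and let f̃ : S² → S² be a continuous map satisfying p ∘ f̃ = f ∘ p. Then f̃ is not homotopic to a constant map. -/
open CategoryTheory

/-- The quotient topology on the projectivization, induced from the nonzero vectors. -/
instance projectivizationTopology {K V : Type*} [DivisionRing K] [AddCommGroup V]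
    [Module K V] [TopologicalSpace V] : TopologicalSpace (Projectivization K V) :=
  instTopologicalSpaceQuotient

/-- The homomorphism of fundamental groups induced by a continuous map. -/
noncomputable def inducedPiOneHom {X Y : Type} [TopologicalSpace X] [TopologicalSpace Y]
    (f : C(X, Y)) (x : X) :
    Aut (FundamentalGroupoid.mk x) →* Aut (FundamentalGroupoid.mk (f x)) :=
  Functor.mapAut (FundamentalGroupoid.mk x)
    ((FundamentalGroupoid.fundamentalGroupoidFunctor.map
        (X := TopCat.of X) (Y := TopCat.of Y) (TopCat.ofHom f) :
        FundamentalGroupoid.fundamentalGroupoidFunctor.obj (TopCat.of X) ⟶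
          FundamentalGroupoid.fundamentalGroupoidFunctor.obj (TopCat.of Y)) :
      FundamentalGroupoid X ⥤ FundamentalGroupoid Y)

/-- The canonical two-fold covering `S² → ℝP²`, sending a unit vector to the line
through it. -/
noncomputable def sphereToRPTwo :
    (Metric.sphere (0 : EuclideanSpace ℝ (Fin 3)) 1) →
      Projectivization ℝ (EuclideanSpace ℝ (Fin 3)) :=
  fun x => Projectivization.mk ℝ (x : EuclideanSpace ℝ (Fin 3)) (ne_zero_of_mem_unit_sphere x)

open Topology Quaternion

section AntipodalCover

variable {E : Type*} [NormedAddCommGroup E] [NormedSpace ℝ E]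

/-- The unit vector in the direction of a nonzero vector. -/
noncomputable def unitVector (v : {v : E // v ≠ 0}) : Metric.sphere (0 : E) 1 :=
  ⟨‖(v : E)‖⁻¹ • (v : E), by simp [norm_smul, norm_ne_zero_iff.mpr v.2]⟩

theorem continuous_unitVector : Continuous (unitVector (E := E)) := by
  refine Continuous.subtype_mk (Continuous.smul (Continuous.inv₀ (by fun_prop) fun v => ?_)
    (by fun_prop)) _
  exact norm_ne_zero_iff.mpr v.2

theorem mk_unitVector (v : {v : E // v ≠ 0}) :
    Projectivization.mk ℝ (unitVector v : E) (ne_zero_of_mem_unit_sphere _) =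
      Projectivization.mk ℝ (v : E) v.2 := by
  rw [Projectivization.mk_eq_mk_iff']
  exact ⟨‖(v : E)‖⁻¹, rfl⟩

theorem dist_neg_self_of_mem_unit_sphere (x : Metric.sphere (0 : E) 1) : dist x (-x) = 2 := by
  rw [Subtype.dist_eq, dist_eq_norm, coe_neg_sphere, sub_neg_eq_add, ← two_smul ℝ, norm_smul,
    norm_eq_of_mem_sphere]
  norm_num

theorem ne_neg_self_of_mem_unit_sphere (x : Metric.sphere (0 : E) 1) : x ≠ -x := fun h => by
  have := dist_neg_self_of_mem_unit_sphere x
  rw [← h, dist_self] at this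
  norm_num at this

theorem unit_sphere_real_eq (g : Metric.sphere (0 : ℝ) 1) : g = 1 ∨ g = -1 := by
  have := norm_eq_of_mem_sphere g
  rw [Real.norm_eq_abs, abs_eq zero_le_one] at this
  exact this.imp (fun h => Subtype.ext h) fun h => Subtype.ext h

theorem neg_one_smul_unit_sphere (x : Metric.sphere (0 : E) 1) :
    (-1 : Metric.sphere (0 : ℝ) 1) • x = -x :=
  Subtype.ext (neg_one_smul ℝ (x : E))

theorem mk_eq_mk_iff_of_mem_unit_sphere (x y : Metric.sphere (0 : E) 1) :
    Projectivization.mk ℝ (x : E) (ne_zero_of_mem_unit_sphere x) =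
      Projectivization.mk ℝ (y : E) (ne_zero_of_mem_unit_sphere y) ↔ x = y ∨ x = -y := by
  rw [Projectivization.mk_eq_mk_iff']
  constructor
  · rintro ⟨a, ha⟩
    have h := congrArg norm ha
    rw [norm_smul, norm_eq_of_mem_sphere, norm_eq_of_mem_sphere, mul_one, Real.norm_eq_abs,
      abs_eq zero_le_one] at h
    rcases h with rfl | rfl
    · exact .inl (Subtype.ext (by simpa using ha.symm))
    · exact .inr (Subtype.ext (by simpa using ha.symm))
  · rintro (rfl | rfl)
    · exact ⟨1, by simp⟩
    · exact ⟨-1, by simp⟩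

/-- The antipodal double cover of a projective space by the unit sphere. -/
theorem isQuotientCoveringMap_unit_sphere_projectivization :
    IsQuotientCoveringMap
      (fun x : Metric.sphere (0 : E) 1 =>
        Projectivization.mk ℝ (x : E) (ne_zero_of_mem_unit_sphere x))
      (Metric.sphere (0 : ℝ) 1) where
  toIsQuotientMap := by
    have hq : IsQuotientMap (fun v : {v : E // v ≠ 0} => Projectivization.mk ℝ (v : E) v.2) :=
      isQuotientMap_quotient_mk'
    refine IsQuotientMap.of_comp continuous_unitVector ?_ (g := fun x : Metric.sphere (0 : E) 1 =>
        Projectivization.mk ℝ (x : E) (ne_zero_of_mem_unit_sphere x)) ?_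
    · exact hq.continuous.comp (Continuous.subtype_mk continuous_subtype_val
        fun x => ne_zero_of_mem_unit_sphere x)
    · convert hq using 1
      exact funext mk_unitVector
  continuous_const_smul g := continuous_const_smul g
  apply_eq_iff_mem_orbit {x y} := by
    rw [mk_eq_mk_iff_of_mem_unit_sphere, MulAction.mem_orbit_iff]
    constructor
    · rintro (rfl | rfl)
      · exact ⟨1, one_smul _ _⟩
      · exact ⟨-1, neg_one_smul_unit_sphere _⟩
    · rintro ⟨g, rfl⟩
      rcases unit_sphere_real_eq g with rfl | rfl
      · simp
      · exact .inr (neg_one_smul_unit_sphere _)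
  disjoint x := by
    refine ⟨Metric.ball x 1, Metric.ball_mem_nhds x one_pos, fun g hg => ?_⟩
    rcases unit_sphere_real_eq g with rfl | rfl
    · rfl
    · obtain ⟨_, ⟨y, hy, rfl⟩, hy'⟩ := hg
      simp only [neg_one_smul_unit_sphere, Metric.mem_ball] at hy hy'
      have := dist_triangle_right y (-y) x
      rw [dist_neg_self_of_mem_unit_sphere] at this
      linarith

end AntipodalCover

theorem isCoveringMap_sphereToRPTwo : IsCoveringMap sphereToRPTwo :=
  isQuotientCoveringMap_unit_sphere_projectivization.isCoveringMap

/-- Two paths with the same origin whose images under a covering map are homotopic have the same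
endpoint. -/
theorem IsCoveringMap.target_eq_of_homotopicRel_comp {E X : Type*} [TopologicalSpace E]
    [TopologicalSpace X] {p : E → X} (cov : IsCoveringMap p) {γ₀ γ₁ : C(unitInterval, E)}
    (h₀ : γ₀ 0 = γ₁ 0)
    (h : (ContinuousMap.comp ⟨p, cov.continuous⟩ γ₀).HomotopicRel
      (ContinuousMap.comp ⟨p, cov.continuous⟩ γ₁) {0, 1}) : γ₀ 1 = γ₁ 1 := by
  obtain ⟨H⟩ := (cov.homotopicRel_iff_comp ⟨0, .inl rfl, h₀⟩).mpr h
  rw [← H.eq_fst 0 (.inr rfl), ← H.eq_snd 0 (.inr rfl)]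

/-- The unit sphere of `ℝ³`. -/
local notation "S2" => Metric.sphere (0 : EuclideanSpace ℝ (Fin 3)) 1

theorem isPathConnected_sphereTwo : IsPathConnected (S2 : Set (EuclideanSpace ℝ (Fin 3))) :=
  isPathConnected_sphere (by simp [← Module.finrank_eq_rank]) 0 zero_le_one

instance : PathConnectedSpace S2 :=
  isPathConnected_iff_pathConnectedSpace.mp isPathConnected_sphereTwo

/-- A lift to the sphere of a self-map of the projective plane is even or odd. -/
theorem even_or_odd_of_sphereToRPTwo_comp
    {f : Projectivization ℝ (EuclideanSpace ℝ (Fin 3)) →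
      Projectivization ℝ (EuclideanSpace ℝ (Fin 3))} {ft : C(S2, S2)}
    (hcomm : ∀ x, sphereToRPTwo (ft x) = f (sphereToRPTwo x)) :
    (∀ x, ft (-x) = ft x) ∨ ∀ x, ft (-x) = -ft x := by
  have hor (x) : ft (-x) = ft x ∨ ft (-x) = -ft x := by
    refine (mk_eq_mk_iff_of_mem_unit_sphere _ _).mp ?_
    change sphereToRPTwo (ft (-x)) = sphereToRPTwo (ft x)
    rw [hcomm, hcomm]
    exact congrArg f ((mk_eq_mk_iff_of_mem_unit_sphere _ _).mpr (.inr rfl))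
  have hclosed : IsClosed {x | ft (-x) = ft x} :=
    isClosed_eq (by fun_prop) (by fun_prop)
  have hclosed' : IsClosed {x | ft (-x) = -ft x} :=
    isClosed_eq (by fun_prop) (by fun_prop)
  have hcompl : {x | ft (-x) = ft x}ᶜ = {x | ft (-x) = -ft x} := by
    ext x
    refine ⟨fun h => (hor x).resolve_left h, fun h h' => ?_⟩
    exact ne_neg_self_of_mem_unit_sphere (ft x) (h'.symm.trans h)
  rcases isClopen_iff.mp ⟨hclosed, isClosed_compl_iff.mp (hcompl ▸ hclosed')⟩ with h | h
  · right
    intro x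
    have : x ∈ {x | ft (-x) = ft x}ᶜ := by simp [h]
    rwa [hcompl] at this
  · exact .inl fun x => (h ▸ Set.mem_univ x : x ∈ {x | ft (-x) = ft x})

/-- If a self-map of the projective plane is surjective on fundamental groups, then its lifts to
the sphere are not even. -/
theorem not_even_of_inducedPiOneHom_surjective
    {f : C(Projectivization ℝ (EuclideanSpace ℝ (Fin 3)),
      Projectivization ℝ (EuclideanSpace ℝ (Fin 3)))}
    {b : Projectivization ℝ (EuclideanSpace ℝ (Fin 3))}
    (hf : Function.Surjective (inducedPiOneHom f b)) {ft : C(S2, S2)}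
    (hcomm : ∀ x, sphereToRPTwo (ft x) = f (sphereToRPTwo x)) :
    ¬ ∀ x, ft (-x) = ft x := by
  intro heven
  have cov := isCoveringMap_sphereToRPTwo
  obtain ⟨x, rfl⟩ : ∃ x, sphereToRPTwo x = b :=
    isQuotientCoveringMap_unit_sphere_projectivization.surjective b
  have hneg (y) : sphereToRPTwo (-y) = sphereToRPTwo y :=
    (mk_eq_mk_iff_of_mem_unit_sphere _ _).mpr (.inr rfl)
  let γ : Path (ft x) (-ft x) := PathConnectedSpace.somePath _ _
  let δ : Path (f (sphereToRPTwo x)) (f (sphereToRPTwo x)) :=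
    (γ.map cov.continuous).cast (hcomm x).symm (by rw [hneg, hcomm])
  obtain ⟨α, hα⟩ := hf ((Groupoid.isoEquivHom _ _).symm (Path.Homotopic.Quotient.mk δ))
  have hα' := congrArg Iso.hom hα
  obtain ⟨β, hβ⟩ := Path.Homotopic.Quotient.mk_surjective (α.hom : Path.Homotopic.Quotient _ _)
  have hβδ : Path.Homotopic.Quotient.mk (β.map f.continuous) = Path.Homotopic.Quotient.mk δ := by
    refine Eq.trans ?_ hα'
    change Path.Homotopic.Quotient.map (Path.Homotopic.Quotient.mk β) f =
      Path.Homotopic.Quotient.map α.hom f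
    rw [hβ]
  have hhom := Path.Homotopic.Quotient.eq.mp hβδ
  let Γ := cov.liftPath β x β.source
  have hΓ (t) : sphereToRPTwo (Γ t) = β t := congrFun (cov.liftPath_lifts β x β.source) t
  have hΓ₀ : Γ 0 = x := cov.liftPath_zero β x β.source
  have hΓ₁ : ft (Γ 1) = ft x := by
    have h := (hΓ 1).trans β.target
    rcases (mk_eq_mk_iff_of_mem_unit_sphere _ _).mp h with h | h
    · rw [h]
    · rw [h, heven]
  have key : (ft.comp Γ) 1 = (γ : C(unitInterval, S2)) 1 := by
    refine cov.target_eq_of_homotopicRel_comp (by simp [hΓ₀]) ?_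
    have hcomp : ContinuousMap.comp ⟨sphereToRPTwo, cov.continuous⟩ (ft.comp Γ) =
        (β.map f.continuous : C(unitInterval, _)) := by
      ext1 t
      simp [hcomm, hΓ]
    rw [hcomp]
    exact hhom
  simp only [ContinuousMap.comp_apply, hΓ₁] at key
  exact ne_neg_self_of_mem_unit_sphere (ft x) (key.trans γ.target)

section HopfLift

/-- The quaternion with given components. -/
def quaternionOfComponents (a b c d : ℝ) : ℍ[ℝ] := ⟨a, b, c, d⟩

section Components

variable (a b c d : ℝ)

@[simp] theorem quaternionOfComponents_re : (quaternionOfComponents a b c d).re = a := rfl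
@[simp] theorem quaternionOfComponents_imI : (quaternionOfComponents a b c d).imI = b := rfl
@[simp] theorem quaternionOfComponents_imJ : (quaternionOfComponents a b c d).imJ = c := rfl
@[simp] theorem quaternionOfComponents_imK : (quaternionOfComponents a b c d).imK = d := rfl

end Components

/-- A vector of `ℝ³` as a purely imaginary quaternion. -/
def imaginaryQuaternion (x : EuclideanSpace ℝ (Fin 3)) : ℍ[ℝ] :=
  quaternionOfComponents 0 (x 0) (x 1) (x 2)

theorem continuous_imaginaryQuaternion : Continuous imaginaryQuaternion := by
  have h (x) : imaginaryQuaternion x =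
      Quaternion.linearIsometryEquivTuple.symm (WithLp.toLp 2 ![0, x 0, x 1, x 2]) := rfl
  rw [funext h]
  fun_prop

theorem imaginaryQuaternion_neg (x : EuclideanSpace ℝ (Fin 3)) :
    imaginaryQuaternion (-x) = -imaginaryQuaternion x := by
  apply Quaternion.ext <;> simp [imaginaryQuaternion]

theorem imaginaryQuaternion_injective : Function.Injective imaginaryQuaternion := by
  intro x y h
  ext i
  fin_cases i
  exacts [congrArg QuaternionAlgebra.imI h, congrArg QuaternionAlgebra.imJ h,
    congrArg QuaternionAlgebra.imK h]

theorem imaginaryQuaternion_mul_self (x : S2) :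
    imaginaryQuaternion x * imaginaryQuaternion x = -1 := by
  have h := norm_eq_of_mem_sphere x
  rw [EuclideanSpace.norm_eq, Real.sqrt_eq_one, Fin.sum_univ_three] at h
  simp only [Real.norm_eq_abs, sq_abs] at h
  apply Quaternion.ext <;> simp [imaginaryQuaternion] <;> linarith

/-- The quaternion `i`. -/
def quaternionI : ℍ[ℝ] := quaternionOfComponents 0 1 0 0

theorem quaternionI_mul_self : quaternionI * quaternionI = -1 := by
  apply Quaternion.ext <;> simp [quaternionI]

/-- A map to the sphere lifts through the Hopf map `q ↦ q i q⁻¹` on nonzero quaternions. -/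
def HopfLiftable {X : Type*} [TopologicalSpace X] (g : C(X, S2)) : Prop :=
  ∃ A : C(X, ℍ[ℝ]), ∀ x, A x ≠ 0 ∧ imaginaryQuaternion (g x) * A x = A x * quaternionI

theorem one_sub_mul_ne_zero {a b : ℍ[ℝ]} (ha : a * a = -1) (h : b ≠ -a) : 1 - b * a ≠ 0 := by
  intro h0
  apply h
  have : (1 - b * a) * a = a + b := by rw [sub_mul, mul_assoc, ha]; simp
  rw [h0, zero_mul] at this
  exact eq_neg_of_add_eq_zero_right this.symm

theorem intertwine_one_sub_mul {a b A i : ℍ[ℝ]} (ha : a * a = -1) (hb : b * b = -1)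
    (hA : a * A = A * i) : b * ((1 - b * a) * A) = (1 - b * a) * A * i := by
  rw [mul_assoc _ A, ← hA, ← mul_assoc, ← mul_assoc]
  congr 1
  rw [mul_sub, sub_mul, ← mul_assoc b b, hb, mul_assoc b a a, ha]
  simp [add_comm]

theorem hopfLiftable_const {X : Type*} [TopologicalSpace X] (y : S2) :
    HopfLiftable (ContinuousMap.const X y) := by
  by_cases h : imaginaryQuaternion y = -quaternionI
  · refine ⟨.const X (quaternionOfComponents 0 0 1 0), fun x => ⟨fun h0 => ?_, ?_⟩⟩
    · simpa using congrArg QuaternionAlgebra.imJ h0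
    · simp only [ContinuousMap.const_apply, h]
      apply Quaternion.ext <;> simp [quaternionI]
  · refine ⟨.const X (1 - imaginaryQuaternion y * quaternionI),
      fun x => ⟨one_sub_mul_ne_zero quaternionI_mul_self h, ?_⟩⟩
    simpa using intertwine_one_sub_mul (A := 1) quaternionI_mul_self
      (imaginaryQuaternion_mul_self y) (by simp)

theorem HopfLiftable.of_dist_lt {X : Type*} [TopologicalSpace X] {g g' : C(X, S2)}
    (hg : HopfLiftable g) (h : ∀ x, dist (g x) (g' x) < 2) : HopfLiftable g' := by
  obtain ⟨A, hA⟩ := hg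
  have hq := continuous_imaginaryQuaternion
  refine ⟨⟨fun x => (1 - imaginaryQuaternion (g' x) * imaginaryQuaternion (g x)) * A x,
    by fun_prop⟩, fun x => ⟨mul_ne_zero (one_sub_mul_ne_zero (imaginaryQuaternion_mul_self _)
      fun h' => ?_) (hA x).1, intertwine_one_sub_mul (imaginaryQuaternion_mul_self _)
        (imaginaryQuaternion_mul_self _) (hA x).2⟩⟩
  rw [← imaginaryQuaternion_neg] at h'
  have hneg : g' x = -g x := Subtype.ext (imaginaryQuaternion_injective h')
  have := h x
  rw [hneg, dist_neg_self_of_mem_unit_sphere] at this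
  exact this.false

theorem HopfLiftable.of_homotopic {X : Type*} [TopologicalSpace X] [CompactSpace X]
    {g g' : C(X, S2)} (hg : HopfLiftable g) (h : g.Homotopic g') : HopfLiftable g' := by
  obtain ⟨H⟩ := h
  have hstep {k k' : C(X, S2)} (hk : HopfLiftable k) (hd : dist k k' < 2) : HopfLiftable k' :=
    hk.of_dist_lt fun x => (ContinuousMap.dist_apply_le_dist x).trans_lt hd
  have hclopen : IsClopen {k : C(X, S2) | HopfLiftable k} := by
    constructor
    · rw [← isOpen_compl_iff, Metric.isOpen_iff]
      exact fun k hk => ⟨2, two_pos, fun k' hk' hl => hk (hstep hl hk')⟩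
    · rw [Metric.isOpen_iff]
      exact fun k hk => ⟨2, two_pos, fun k' hk' => hstep hk (by rwa [dist_comm])⟩
  have huniv := (hclopen.preimage H.toContinuousMap.curry.continuous).eq_univ
    ⟨0, by
      have h0 : H.toContinuousMap.curry 0 = g := by ext1 x; simp
      rwa [Set.mem_preimage, h0]⟩
  have h1 : (1 : unitInterval) ∈ H.toContinuousMap.curry ⁻¹' {k | HopfLiftable k} :=
    huniv ▸ Set.mem_univ _
  have h1' : H.toContinuousMap.curry 1 = g' := by ext1 x; simp
  rwa [Set.mem_preimage, h1'] at h1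

theorem re_eq_zero_and_imI_eq_zero_of_anticommute {w : ℍ[ℝ]}
    (h : w * quaternionI = -(quaternionI * w)) : w.re = 0 ∧ w.imI = 0 := by
  have h1 := congrArg QuaternionAlgebra.imI h
  have h0 := congrArg QuaternionAlgebra.re h
  simp [quaternionI] at h1 h0
  constructor <;> linarith

/-- A Hopf lift of an odd map yields a map from the sphere to the punctured plane that is odd up to
positive factors. -/
theorem HopfLiftable.exists_odd_map_complex {g : C(S2, S2)} (hg : HopfLiftable g)
    (hodd : ∀ x, g (-x) = -g x) :
    ∃ u : C(S2, ℂ), (∀ x, u x ≠ 0) ∧ ∀ x, ∃ r : ℝ, 0 < r ∧ u (-x) = -(r * u x) := by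
  obtain ⟨A, hA⟩ := hg
  have hA0 (x) := (hA x).1
  let w (x : S2) : ℍ[ℝ] := (A x)⁻¹ * A (-x)
  have hw : Continuous w := (A.continuous.inv₀ hA0).mul (by fun_prop)
  have hmul (x) : w x * w (-x) = 1 := by
    simp only [w, neg_neg]
    rw [mul_assoc, mul_inv_cancel_left₀ (hA0 _), inv_mul_cancel₀ (hA0 _)]
  have hzero (x) : (w x).re = 0 ∧ (w x).imI = 0 := by
    refine re_eq_zero_and_imI_eq_zero_of_anticommute ?_
    have h1 : (A x)⁻¹ * imaginaryQuaternion (g x) = quaternionI * (A x)⁻¹ := by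
      rw [inv_mul_eq_iff_eq_mul₀ (hA0 x), ← mul_assoc, eq_mul_inv_iff_mul_eq₀ (hA0 x), (hA x).2]
    simp only [w]
    rw [mul_assoc, ← (hA (-x)).2, hodd, coe_neg_sphere, imaginaryQuaternion_neg, ← mul_assoc,
      mul_neg, h1, neg_mul, mul_assoc]
  have hre (x) := (hzero x).1
  have himI (x) := (hzero x).2
  have hw0 (x) : w x ≠ 0 := left_ne_zero_of_mul (hmul x ▸ one_ne_zero)
  have hn (x) : 0 < Quaternion.normSq (w x) :=
    lt_of_le_of_ne Quaternion.normSq_nonneg (Quaternion.normSq_ne_zero.mpr (hw0 x)).symm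
  have hneg (x) : w (-x) = -((Quaternion.normSq (w x))⁻¹ • w x) := by
    have hstar : star (w x) = -w x := Quaternion.star_eq_neg.mpr (hre x)
    have hinv : (w x)⁻¹ = (Quaternion.normSq (w x))⁻¹ • star (w x) := rfl
    rw [eq_inv_of_mul_eq_one_right (hmul x), hinv, hstar, smul_neg]
  refine ⟨⟨fun x => ⟨(w x).imJ, (w x).imK⟩, ?_⟩, fun x h => hw0 x ?_, fun x =>
    ⟨(Quaternion.normSq (w x))⁻¹, inv_pos.mpr (hn x), ?_⟩⟩
  · exact Complex.equivRealProdCLM.symm.continuous.comp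
      ((Quaternion.continuous_imJ.comp hw).prodMk (Quaternion.continuous_imK.comp hw))
  · ext
    · exact hre x
    · exact himI x
    · exact congrArg Complex.re h
    · exact congrArg Complex.im h
  · apply Complex.ext
    · exact (congrArg QuaternionAlgebra.imJ (hneg x)).trans (by simp; exact .inl rfl)
    · exact (congrArg QuaternionAlgebra.imK (hneg x)).trans (by simp; exact .inl rfl)

end HopfLift

/-- There is a map from the plane to the sphere that is odd on the unit circle, namely the one
carrying the closed disc to a hemisphere. -/
theorem exists_continuousMap_complex_sphereTwo_odd_on_circle :
    ∃ v : C(ℂ, S2), ∀ z : ℂ, ‖z‖ = 1 → v (-z) = -v z := by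
  let v₀ (z : ℂ) : EuclideanSpace ℝ (Fin 3) := !₂[z.re, z.im, √(1 - ‖z‖ ^ 2)]
  have hv₀ (z) : v₀ z ≠ 0 := fun h => by
    have h0 : z.re = 0 := congrArg (fun x : EuclideanSpace ℝ (Fin 3) => x 0) h
    have h1 : z.im = 0 := congrArg (fun x : EuclideanSpace ℝ (Fin 3) => x 1) h
    have h2 : √(1 - ‖z‖ ^ 2) = 0 := congrArg (fun x : EuclideanSpace ℝ (Fin 3) => x 2) h
    have hz : z = 0 := Complex.ext h0 h1
    simp [hz] at h2
  refine ⟨⟨fun z => unitVector ⟨v₀ z, hv₀ z⟩, continuous_unitVector.comp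
    (Continuous.subtype_mk (by fun_prop) _)⟩, fun z hz => Subtype.ext ?_⟩
  have hneg : v₀ (-z) = -v₀ z := by
    ext i
    fin_cases i <;> simp [v₀, hz]
  simp [unitVector, hneg]

/-- The two-dimensional Borsuk-Ulam theorem, for maps that are odd up to positive factors. -/
theorem not_exists_odd_map_complex {u : C(S2, ℂ)} (hu : ∀ x, u x ≠ 0) :
    ¬ ∀ x, ∃ r : ℝ, 0 < r ∧ u (-x) = -(r * u x) := by
  intro hodd
  obtain ⟨v, hv⟩ := exists_continuousMap_complex_sphereTwo_odd_on_circle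
  obtain ⟨θ, ⟨-, hθ⟩, -⟩ := Complex.isCoveringMapOn_exp.existsUnique_continuousMap_lifts
    (u.comp v) (a₀ := 0) (e₀ := Complex.log (u (v 0))) (Complex.exp_log (hu _)) fun z => hu _
  replace hθ (z) : Complex.exp (θ z) = u (v z) := congrFun hθ z
  obtain ⟨z, hz, hz0⟩ : ∃ z ∈ Metric.sphere (0 : ℂ) 1, (θ (-z)).im - (θ z).im = 0 := by
    have hconn : IsPreconnected (Metric.sphere (0 : ℂ) 1) :=
      isPreconnected_sphere (by simp [← Module.finrank_eq_rank]) 0 1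
    let d (z : ℂ) : ℝ := (θ (-z)).im - (θ z).im
    have hd : Continuous d := by fun_prop
    have hdneg : d (-1) = -d 1 := by simp [d]
    have h1 : (1 : ℂ) ∈ Metric.sphere (0 : ℂ) 1 := by simp
    have h2 : (-1 : ℂ) ∈ Metric.sphere (0 : ℂ) 1 := by simp
    rcases le_total (d 1) 0 with h | h
    · exact hconn.intermediate_value h1 h2 hd.continuousOn ⟨h, by linarith⟩
    · exact hconn.intermediate_value h2 h1 hd.continuousOn ⟨by linarith, h⟩
  obtain ⟨r, hr, hur⟩ := hodd (v z)
  rw [← hv z (by simpa using hz), ← hθ, ← hθ, ← Complex.re_add_im (θ (-z)),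
    ← Complex.re_add_im (θ z), sub_eq_zero.mp hz0, Complex.exp_add, Complex.exp_add, ← mul_assoc,
    ← neg_mul, mul_left_inj' (Complex.exp_ne_zero _)] at hur
  have hreal : Real.exp (θ (-z)).re = -(r * Real.exp (θ z).re) := by exact_mod_cast hur
  have := Real.exp_pos (θ (-z)).re
  have := mul_pos hr (Real.exp_pos (θ z).re)
  linarith

/-- Lemma 5 of the paper: if `f : ℝP² → ℝP²` induces an isomorphism on the fundamental
group, then any map `f̃ : S² → S²` covering `f` is not null-homotopic. -/
theorem cover_of_piOne_iso_selfmap_of_projective_plane_not_nullhomotopic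
    (f : C(Projectivization ℝ (EuclideanSpace ℝ (Fin 3)),
           Projectivization ℝ (EuclideanSpace ℝ (Fin 3))))
    (b : Projectivization ℝ (EuclideanSpace ℝ (Fin 3)))
    (hf : Function.Bijective (inducedPiOneHom f b))
    (ft : C((Metric.sphere (0 : EuclideanSpace ℝ (Fin 3)) 1),
            (Metric.sphere (0 : EuclideanSpace ℝ (Fin 3)) 1)))
    (hcomm : ∀ x, sphereToRPTwo (ft x) = f (sphereToRPTwo x)) :
    ¬ ∃ y, ContinuousMap.Homotopic ft (ContinuousMap.const _ y) := by
  rintro ⟨y, hy⟩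
  have hodd := (even_or_odd_of_sphereToRPTwo_comp hcomm).resolve_left
    (not_even_of_inducedPiOneHom_surjective hf.surjective hcomm)
  obtain ⟨u, hu, hu'⟩ :=
    ((hopfLiftable_const y).of_homotopic hy.symm).exists_odd_map_complex hodd
  exact not_exists_odd_map_complex hu hu'
end

section
/- Let C ⊂ ℝP³ be the affine unknot, namely the set of points Projectivization.mk ℝ v where v ranges over the vectors (1, cos θ, sin θ, 0) for θ ∈ ℝ. Then for any basepoint x₀ in ℝP³ \ C, the fundamental group π₁(ℝP³ \ C, x₀) is isomorphic to the free product ℤ ∗ (ℤ/2ℤ) of an infinite cyclic group and a cyclic group of order 2. -/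
namespace Path.Homotopic.Quotient

open Set unitInterval

variable {X : Type*} [TopologicalSpace X]

/-- A property of homotopy classes of paths that is stable under concatenation and holds for
paths lying in a member of an open cover holds for every class. -/
theorem induction_of_openCover {ι : Type*} {W : ι → Set X} (hW : ∀ i, IsOpen (W i))
    (hcover : ∀ x, ∃ i, x ∈ W i) {P : ∀ x y : X, Path.Homotopic.Quotient x y → Prop}
    (small : ∀ (i : ι) (x y : X) (γ : Path x y), range γ ⊆ W i → P x y (mk γ))
    (trans : ∀ (x y z : X) (γ : Path.Homotopic.Quotient x y) (δ : Path.Homotopic.Quotient y z),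
      P x y γ → P y z δ → P x z (γ.trans δ))
    {x y : X} (γ : Path.Homotopic.Quotient x y) : P x y γ := by
  induction γ using Path.Homotopic.Quotient.ind with | mk γ =>
  obtain ⟨t, ht0, htm, ⟨n, hn⟩, ht⟩ := exists_monotone_Icc_subset_open_cover_unitInterval
    (c := fun i ↦ γ ⁻¹' W i) (fun i ↦ (hW i).preimage γ.continuous)
    (fun s _ ↦ mem_iUnion.2 (hcover (γ s)))
  have key : ∀ m, P (γ (t 0)) (γ (t m)) (mk (γ.subpath (t 0) (t m))) := by
    intro m
    induction m with
    | zero =>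
      obtain ⟨i, hi⟩ := ht 0
      refine small i _ _ _ ?_
      rw [Path.subpath_self]
      rintro _ ⟨s, rfl⟩
      exact hi ⟨le_rfl, htm (Nat.zero_le 1)⟩
    | succ m ih =>
      obtain ⟨i, hi⟩ := ht m
      have h := trans _ _ _ _ _ ih (small i _ _ (γ.subpath (t m) (t (m + 1))) (by
        rw [Path.range_subpath_of_le _ _ _ (htm (Nat.le_succ m))]
        exact image_subset_iff.2 hi))
      rwa [← mk_trans, eq.2 ⟨Path.Homotopy.subpathTransSubpath γ _ _ _⟩] at h
  have h := key n
  rw [ht0, hn n le_rfl, Path.subpath_zero_one, mk_cast] at h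
  have aux : ∀ {x' y' : X} (hx : x' = x) (hy : y' = y),
      P x' y' ((mk γ).cast hx hy) → P x y (mk γ) := by
    rintro _ _ rfl rfl h
    rwa [cast_rfl_rfl] at h
  exact aux _ _ h

/-- The class of paths between two points of a simply connected subset that stay in the subset. -/
noncomputable def within {s : Set X} (hs : IsSimplyConnected s) {x y : X} (hx : x ∈ s)
    (hy : y ∈ s) : Path.Homotopic.Quotient x y :=
  mk (hs.isPathConnected.joinedIn x hx y hy).somePath

theorem mk_eq_within {s : Set X} (hs : IsSimplyConnected s) {x y : X} (hx : x ∈ s)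
    (hy : y ∈ s) (γ : Path x y) (hγ : ∀ t, γ t ∈ s) : mk γ = within hs hx hy := by
  have := hs.simplyConnectedSpace
  have lift : ∀ γ : Path x y, (∀ t, γ t ∈ s) → ∃ γ' : Path (⟨x, hx⟩ : s) ⟨y, hy⟩,
      γ'.map continuous_subtype_val = γ := fun γ hγ ↦
    ⟨{ toFun := fun t ↦ ⟨γ t, hγ t⟩
       continuous_toFun := by fun_prop
       source' := by simp
       target' := by simp }, by ext; rfl⟩
  obtain ⟨γ₁, rfl⟩ := lift γ hγ
  obtain ⟨γ₂, h₂⟩ := lift _ (hs.isPathConnected.joinedIn x hx y hy).somePath_mem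
  rw [within, ← h₂]
  exact eq.2 ((SimplyConnectedSpace.paths_homotopic γ₁ γ₂).map ⟨_, continuous_subtype_val⟩)

theorem within_trans {s : Set X} (hs : IsSimplyConnected s) {x y z : X} (hx : x ∈ s)
    (hy : y ∈ s) (hz : z ∈ s) :
    (within hs hx hy).trans (within hs hy hz) = within hs hx hz := by
  rw [within, within, ← mk_trans]
  refine mk_eq_within hs hx hz _ fun t ↦ ?_
  rw [Path.trans_apply]
  split_ifs
  exacts [(hs.isPathConnected.joinedIn x hx y hy).somePath_mem _,
    (hs.isPathConnected.joinedIn y hy z hz).somePath_mem _]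

theorem within_self {s : Set X} (hs : IsSimplyConnected s) {x : X} (hx : x ∈ s) :
    within hs hx hx = refl x :=
  (mk_eq_within hs hx hx (Path.refl x) fun _ ↦ hx).symm

/-- Paths in the intersection of two simply connected subsets represent the same class. -/
theorem within_eq_within {s s' : Set X} (hs : IsSimplyConnected s) (hs' : IsSimplyConnected s')
    {x y : X} (h : JoinedIn (s ∩ s') x y) :
    within hs h.source_mem.1 h.target_mem.1 = within hs' h.source_mem.2 h.target_mem.2 := by
  rw [← mk_eq_within hs _ _ h.somePath fun t ↦ (h.somePath_mem t).1,
    ← mk_eq_within hs' _ _ h.somePath fun t ↦ (h.somePath_mem t).2]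

end Path.Homotopic.Quotient

namespace FiberBundleCore

open unitInterval

variable {ι X F : Type*} [TopologicalSpace X] [TopologicalSpace F]
  (Z : FiberBundleCore ι X F)

theorem isCoveringMap [DiscreteTopology F] : IsCoveringMap Z.proj :=
  IsCoveringMap.mk _ (fun _ ↦ F) (fun x ↦ Z.localTrivAt x) Z.mem_localTrivAt_baseSet

theorem localTriv_monodromy_mk [DiscreteTopology F] {x y : X} (i : ι) (γ : Path x y)
    (hγ : ∀ t, γ t ∈ Z.baseSet i) (e : Z.proj ⁻¹' {x}) :
    (Z.localTriv i (Z.isCoveringMap.monodromy (.mk γ) e).1).2 = (Z.localTriv i e.1).2 := by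
  obtain ⟨e, rfl⟩ := e
  set v := (Z.localTriv i e).2
  have htarget : ∀ t, (γ t, v) ∈ (Z.localTriv i).target := fun t ↦
    (Z.mem_localTriv_target i _).2 (hγ t)
  have hcont : Continuous fun t ↦ (Z.localTriv i).toOpenPartialHomeomorph.symm (γ t, v) :=
    (Z.localTriv i).toOpenPartialHomeomorph.continuousOn_symm.comp_continuous (by fun_prop) htarget
  have hsource : e ∈ (Z.localTriv i).source :=
    (Z.mem_localTriv_source i e).2 (by simpa using hγ 0)
  have hlift := (Z.isCoveringMap.eq_liftPath_iff' (γ := (γ : C(I, X))) (e := e) γ.source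
    (Γ := ⟨_, hcont⟩)).2 ⟨by
      ext t
      exact (Z.localTriv i).proj_symm_apply (htarget t), by
      change (Z.localTriv i).toOpenPartialHomeomorph.symm (γ 0, v) = e
      rw [γ.source]
      exact (Z.localTriv i).symm_apply_mk_proj hsource⟩
  change (Z.localTriv i (Z.isCoveringMap.liftPath (γ : C(I, X)) e _ 1)).2 = v
  rw [← hlift]
  exact (congrArg Prod.snd ((Z.localTriv i).apply_symm_apply (htarget 1))).trans rfl

theorem localTriv_snd_eq {i j : ι} (e : Z.TotalSpace) (hi : e.1 ∈ Z.baseSet i)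
    (hj : e.1 ∈ Z.baseSet j) :
    (Z.localTriv j e).2 = Z.coordChange i j e.1 (Z.localTriv i e).2 := by
  rw [localTriv_apply, localTriv_apply]
  exact (Z.coordChange_comp _ i j e.1 ⟨⟨Z.mem_baseSet_at _, hi⟩, hj⟩ _).symm

end FiberBundleCore

namespace AffineUnknot

open Set Topology unitInterval Path.Homotopic

/-- Real four-space, with coordinates `(w, x, y, z)`. -/
abbrev V := EuclideanSpace ℝ (Fin 4)

/-- The cones over four star-shaped pieces covering the complement of the affine unknot. -/
def cone (i : Fin 4) : Set V :=
  {v | v i ≠ 0 ∧ (v 3 ≠ 0 ∨ (i = 0 ∧ v 1 ^ 2 + v 2 ^ 2 < v 0 ^ 2) ∨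
    (i ≠ 0 ∧ v 0 ^ 2 < v 1 ^ 2 + v 2 ^ 2))}

theorem ne_zero_of_mem_cone {i : Fin 4} {v : V} (hv : v ∈ cone i) : v ≠ 0 := by
  rintro rfl
  exact hv.1 rfl

theorem smul_mem_cone {i : Fin 4} {c : ℝ} (hc : c ≠ 0) {v : V} (hv : v ∈ cone i) :
    c • v ∈ cone i := by
  have hc2 : 0 < c ^ 2 := by positivity
  refine ⟨mul_ne_zero hc hv.1, ?_⟩
  simp only [PiLp.smul_apply, smul_eq_mul, mul_pow, ← mul_add]
  exact hv.2.imp (mul_ne_zero hc) (Or.imp (And.imp_right (mul_lt_mul_of_pos_left · hc2))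
    (And.imp_right (mul_lt_mul_of_pos_left · hc2)))

theorem isOpen_cone (i : Fin 4) : IsOpen (cone i) := by
  have hc : ∀ k, Continuous fun v : V ↦ v k := fun k ↦ by fun_prop
  exact (isOpen_ne_fun (hc i) continuous_const).inter
    ((isOpen_ne_fun (hc 3) continuous_const).union
      ((isOpen_const.inter (isOpen_lt (((hc 1).pow 2).add ((hc 2).pow 2)) ((hc 0).pow 2))).union
        (isOpen_const.inter (isOpen_lt ((hc 0).pow 2) (((hc 1).pow 2).add ((hc 2).pow 2))))))

/-- The affine unknot, described as the set of points lying in none of the four cones. -/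
def unknot : Set (Projectivization ℝ V) := {p | ∀ i, p.rep ∉ cone i}

/-- The complement of the affine unknot. -/
abbrev Complement := {z : Projectivization ℝ V // z ∉ unknot}

/-- The piece of the complement of the unknot covered by the `i`-th cone. -/
def chart (i : Fin 4) : Set Complement := {p | p.1.rep ∈ cone i}

theorem exists_mem_chart (p : Complement) : ∃ i, p ∈ chart i := by
  by_contra! h
  exact p.2 h

/-- The vectors spanning a point of the complement. -/
abbrev Lift := {v : V // ∃ i, v ∈ cone i}

theorem rep_mk_mem_cone_iff {v : V} (hv : v ≠ 0) (i : Fin 4) :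
    (Projectivization.mk ℝ v hv).rep ∈ cone i ↔ v ∈ cone i := by
  obtain ⟨c, hc⟩ := Projectivization.exists_smul_eq_mk_rep ℝ v hv
  rw [← hc]
  refine ⟨fun h ↦ ?_, smul_mem_cone c.ne_zero⟩
  simpa [Units.smul_def] using smul_mem_cone c⁻¹.ne_zero h

/-- The projection onto the complement of the unknot. -/
noncomputable def proj (v : Lift) : Complement :=
  ⟨Projectivization.mk ℝ v.1 (ne_zero_of_mem_cone v.2.choose_spec), fun h ↦ by
    obtain ⟨i, hi⟩ := v.2
    exact h i ((rep_mk_mem_cone_iff _ i).2 hi)⟩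

theorem proj_mem_chart_iff {v : Lift} {i : Fin 4} : proj v ∈ chart i ↔ v.1 ∈ cone i :=
  rep_mk_mem_cone_iff _ i

theorem exists_rep_proj (v : Lift) : ∃ c : ℝ, c ≠ 0 ∧ (proj v).1.rep = c • v.1 := by
  obtain ⟨c, hc⟩ := Projectivization.exists_smul_eq_mk_rep ℝ v.1
    (ne_zero_of_mem_cone v.2.choose_spec)
  exact ⟨c, c.ne_zero, hc.symm⟩

theorem proj_eq_iff {v u : Lift} : proj v = proj u ↔ ∃ c : ℝ, c • u.1 = v.1 :=
  Subtype.mk_eq_mk.trans (Projectivization.mk_eq_mk_iff' ℝ _ _ _ _)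

/-- The chosen representative of a point of the complement. -/
noncomputable def repLift (p : Complement) : Lift := ⟨p.1.rep, exists_mem_chart p⟩

theorem proj_repLift (p : Complement) : proj (repLift p) = p :=
  Subtype.ext (Projectivization.mk_rep p.1)

theorem continuous_proj : Continuous proj := by
  have h : Continuous (Projectivization.mk' ℝ (V := V)) := continuous_quotient_mk'
  exact (h.comp
    (f := fun v : Lift ↦ (⟨v.1, ne_zero_of_mem_cone v.2.choose_spec⟩ : {v : V // v ≠ 0}))
    (by fun_prop)).subtype_mk _

theorem isOpenQuotientMap_proj : IsOpenQuotientMap proj where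
  surjective p := ⟨repLift p, proj_repLift p⟩
  continuous := continuous_proj
  isOpenMap U hU := by
    obtain ⟨O, hO, rfl⟩ := hU
    set O' : Set V := O ∩ {v | ∃ i, v ∈ cone i}
    have hO' : IsOpen O' := hO.inter (by
      rw [ofPred_exists]
      exact isOpen_iUnion isOpen_cone)
    have hsat : IsOpen {v : {v : V // v ≠ 0} | ∃ c : ℝ, c • v.1 ∈ O'} := by
      rw [ofPred_exists]
      exact isOpen_iUnion fun c ↦ hO'.preimage (by fun_prop)
    have himage : IsOpen {p : Projectivization ℝ V | ∃ c : ℝ, c • p.rep ∈ O'} := by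
      refine isOpen_coinduced.2 ?_
      convert! hsat using 1
      ext v
      obtain ⟨d, hd⟩ := Projectivization.exists_smul_eq_mk_rep ℝ v.1 v.2
      change (∃ c : ℝ, c • (Projectivization.mk ℝ v.1 v.2).rep ∈ O') ↔ _
      rw [← hd]
      constructor
      · rintro ⟨c, hc⟩
        exact ⟨c * d, by rwa [mul_smul]⟩
      · rintro ⟨c, hc⟩
        refine ⟨c * d⁻¹, ?_⟩
        rw [mul_smul]
        simpa [Units.smul_def] using hc
    convert! himage.preimage continuous_subtype_val
    ext p
    constructor
    · rintro ⟨v, hv, rfl⟩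
      obtain ⟨c, hc, h⟩ := exists_rep_proj v
      refine ⟨c⁻¹, ?_⟩
      rw [h, inv_smul_smul₀ hc]
      exact ⟨hv, v.2⟩
    · rintro ⟨c, hc⟩
      exact ⟨⟨c • p.1.rep, hc.2⟩, hc.1,
        (proj_eq_iff.2 ⟨c, rfl⟩ : _ = proj (repLift p)).trans (proj_repLift p)⟩

theorem isOpen_chart (i : Fin 4) : IsOpen (chart i) := by
  rw [← isOpenQuotientMap_proj.isQuotientMap.isOpen_preimage]
  convert! (isOpen_cone i).preimage (continuous_subtype_val (p := fun v ↦ ∃ i, v ∈ cone i))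
  ext v
  exact proj_mem_chart_iff

theorem joinedIn_charts {i j : Fin 4} {v u : V} (h : JoinedIn (cone i ∩ cone j) v u) :
    JoinedIn (chart i ∩ chart j) (proj ⟨v, i, h.source_mem.1⟩) (proj ⟨u, i, h.target_mem.1⟩) := by
  refine ⟨⟨⟨fun t ↦ proj ⟨h.somePath t, i, (h.somePath_mem t).1⟩,
    continuous_proj.comp (by fun_prop)⟩, by simp, by simp⟩, fun t ↦ ⟨?_, ?_⟩⟩
  · exact proj_mem_chart_iff.2 (h.somePath_mem t).1
  · exact proj_mem_chart_iff.2 (h.somePath_mem t).2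

theorem star_mem_cone {i : Fin 4} {v : V} (hv : v ∈ cone i) (hvi : v i = 1) {s : ℝ} (hs : s ∈ I) :
    s • v + (1 - s) • EuclideanSpace.single i 1 ∈ cone i := by
  obtain rfl | hs0 := eq_or_ne s 0
  · fin_cases i <;> simp [cone]
  have hs2 : 0 < s ^ 2 := by positivity
  have hs1 : s ^ 2 ≤ 1 := pow_le_one₀ hs.1 hs.2
  obtain ⟨-, h | ⟨rfl, h⟩ | ⟨hi, h⟩⟩ := hv
  · fin_cases i <;> simp_all [cone]
  · rw [hvi] at h
    suffices (s * v 1) ^ 2 + (s * v 2) ^ 2 < 1 by simpa [cone, hvi] using Or.inr this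
    nlinarith
  · fin_cases i
    · exact absurd rfl hi
    · simp only [Fin.mk_one] at hvi
      rw [hvi] at h
      suffices (s * v 0) ^ 2 < 1 + (s * v 2) ^ 2 by simpa [cone, hvi] using Or.inr this
      nlinarith
    · simp only [Fin.reduceFinMk] at hvi
      rw [hvi] at h
      suffices (s * v 0) ^ 2 < (s * v 1) ^ 2 + 1 by simpa [cone, hvi] using Or.inr this
      nlinarith
    · simp only [Fin.reduceFinMk] at hvi
      simp [cone, hvi]

theorem isSimplyConnected_chart (i : Fin 4) : IsSimplyConnected (chart i) := by
  let n : Complement → V := fun p ↦ (p.1.rep i)⁻¹ • p.1.rep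
  have hn : ContinuousOn n (chart i) := by
    rw [isOpenQuotientMap_proj.isQuotientMap.continuousOn_isOpen_iff (isOpen_chart i)]
    have : n ∘ proj = fun v ↦ (v.1 i)⁻¹ • v.1 := by
      ext1 v
      obtain ⟨c, hc, h⟩ := exists_rep_proj v
      simp only [n, Function.comp_apply, h, PiLp.smul_apply, smul_eq_mul, mul_inv, smul_smul]
      congr 1
      field_simp
    rw [this]
    have hc : Continuous fun v : Lift ↦ v.1 i := by fun_prop
    exact (hc.continuousOn.inv₀ fun v hv ↦ (proj_mem_chart_iff.1 hv).1).smul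
      continuous_subtype_val.continuousOn
  have hnmem : ∀ p ∈ chart i, n p ∈ cone i ∧ n p i = 1 := fun p hp ↦
    ⟨smul_mem_cone (inv_ne_zero hp.1) hp, inv_mul_cancel₀ hp.1⟩
  have hcontr : ContractibleSpace (chart i) := by
    rw [contractible_iff_id_nullhomotopic]
    let H : I × chart i → chart i := fun x ↦
      ⟨proj ⟨(x.1 : ℝ) • n x.2 + (1 - (x.1 : ℝ)) • EuclideanSpace.single i 1, i,
        star_mem_cone (hnmem _ x.2.2).1 (hnmem _ x.2.2).2 x.1.2⟩,
        proj_mem_chart_iff.2 (star_mem_cone (hnmem _ x.2.2).1 (hnmem _ x.2.2).2 x.1.2)⟩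
    have hH : Continuous H := by
      have : Continuous fun x : I × chart i ↦ n x.2 :=
        hn.comp_continuous (by fun_prop) fun x ↦ x.2.2
      have hline : Continuous fun x : I × chart i ↦
          (x.1 : ℝ) • n x.2 + (1 - (x.1 : ℝ)) • (EuclideanSpace.single i 1 : V) :=
        ((continuous_subtype_val.comp continuous_fst).smul this).add
          ((continuous_const.sub (continuous_subtype_val.comp continuous_fst)).smul
            continuous_const)
      exact (continuous_proj.comp (hline.subtype_mk _)).subtype_mk _
    have hcone : EuclideanSpace.single i 1 ∈ cone i := by
      fin_cases i <;> simp [cone]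
    have h : ContinuousMap.Homotopic (ContinuousMap.const _
        ⟨proj ⟨EuclideanSpace.single i 1, i, hcone⟩, proj_mem_chart_iff.2 hcone⟩)
        (ContinuousMap.id (chart i)) := ⟨{
      toFun := H
      continuous_toFun := hH
      map_zero_left := fun x ↦ by simp [H]
      map_one_left := fun x ↦ by
        refine Subtype.ext ?_
        change proj _ = x.1
        refine Eq.trans (proj_eq_iff.2 ?_) (proj_repLift x.1)
        exact ⟨(x.1.1.rep i)⁻¹, by simp [n, repLift]⟩ }⟩
    exact ⟨_, h.symm⟩
  exact SimplyConnectedSpace.ofContractible _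

/-- The vector with the given first three coordinates and last coordinate one. -/
def vec (u : Fin 3 → ℝ) : V := !₂[u 0, u 1, u 2, 1]

theorem vec_mem_cone {u : Fin 3 → ℝ} {i : Fin 4} (hi : vec u i ≠ 0) : vec u ∈ cone i :=
  ⟨hi, Or.inl (by simp [vec])⟩

theorem vec_mem_cone_three (u : Fin 3 → ℝ) : vec u ∈ cone 3 := vec_mem_cone (by simp [vec])

/-- The point of the complement spanned by a vector with last coordinate one. -/
noncomputable def pt (u : Fin 3 → ℝ) : Complement := proj ⟨vec u, 3, vec_mem_cone_three u⟩

theorem pt_mem {u : Fin 3 → ℝ} {i : Fin 4} (hi : vec u i ≠ 0) : pt u ∈ chart i :=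
  proj_mem_chart_iff.2 (vec_mem_cone hi)

/-- The base point of the complement, which lies in all the charts. -/
noncomputable def base : Complement := pt 1

theorem vec_one (i : Fin 4) : vec 1 i = 1 := by
  fin_cases i <;> simp [vec]

theorem base_mem (i : Fin 4) : base ∈ chart i := pt_mem (by simp [vec_one])

theorem joinedIn_pt {u u' : Fin 3 → ℝ} {i j : Fin 4} (hi : 0 < vec u i * vec u' i)
    (hj : 0 < vec u j * vec u' j) : JoinedIn (chart i ∩ chart j) (pt u) (pt u') := by
  refine joinedIn_charts (.of_segment_subset ?_)
  rintro _ ⟨a, b, ha, hb, hab, rfl⟩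
  have key : ∀ k, 0 < vec u k * vec u' k → (a • vec u + b • vec u') k ≠ 0 := by
    intro k hk h
    simp only [PiLp.add_apply, PiLp.smul_apply, smul_eq_mul] at h
    have h1 : a * (vec u k) ^ 2 + b * (vec u k * vec u' k) = 0 := by linear_combination vec u k * h
    have h2 : a * (vec u k * vec u' k) + b * (vec u' k) ^ 2 = 0 := by
      linear_combination vec u' k * h
    obtain rfl : b = 0 := by
      by_contra hb'
      nlinarith [mul_pos (lt_of_le_of_ne hb (Ne.symm hb')) hk, mul_nonneg ha (sq_nonneg (vec u k))]
    obtain rfl : a = 1 := by linarith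
    linarith
  have h3 := key 3 (by simp [vec])
  exact ⟨⟨key i hi, Or.inl h3⟩, key j hj, Or.inl h3⟩

theorem joinedIn_antipodal {s : ℝ} (hs : s ≠ 0) :
    JoinedIn (chart 1 ∩ chart 2) (pt ![1, -1, -s]) (pt ![1, 1, s]) := by
  have h : JoinedIn (cone 1 ∩ cone 2) (!₂[-1, 1, s, -1] : V) !₂[1, 1, s, 1] := by
    refine .of_segment_subset ?_
    rintro _ ⟨a, b, ha, hb, hab, rfl⟩
    obtain rfl : a = 1 - b := by linarith
    have : 2 * b - 1 ≠ 0 ∨ (2 * b - 1) ^ 2 < 1 + s ^ 2 := by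
      by_cases h : 2 * b - 1 = 0
      · exact .inr (by rw [h]; nlinarith [sq_nonneg s])
      · exact .inl h
    have e1 : b - 1 + b = 2 * b - 1 := by ring
    have e2 : (1 - b) * s + b * s = s := by ring
    constructor <;> simpa [cone, e1, e2, hs] using this
  convert joinedIn_charts h using 1
  · exact proj_eq_iff.2 ⟨-1, by ext k; fin_cases k <;> simp [vec]⟩
  · exact proj_eq_iff.2 ⟨1, by ext k; fin_cases k <;> simp [vec]⟩

/-- The class of paths from the base point staying in a chart. -/
noncomputable def radial (i : Fin 4) {p : Complement} (hp : p ∈ chart i) :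
    Path.Homotopic.Quotient base p :=
  Quotient.within (isSimplyConnected_chart i) (base_mem i) hp

theorem radial_base (i : Fin 4) : radial i (base_mem i) = .refl base :=
  Quotient.within_self _ _

theorem radial_trans_within {i : Fin 4} {p q : Complement} (hp : p ∈ chart i) (hq : q ∈ chart i) :
    (radial i hp).trans (Quotient.within (isSimplyConnected_chart i) hp hq) = radial i hq :=
  Quotient.within_trans _ _ _ _

/-- The loop `g` at the base point relates the radial paths of two charts. -/
def Related (i j : Fin 4) (p : Complement) (g : FundamentalGroup Complement base) : Prop :=
  ∃ (hi : p ∈ chart i) (hj : p ∈ chart j),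
    radial i hi = Quotient.trans (FundamentalGroup.toPath g) (radial j hj)

theorem Related.of_joinedIn {i j : Fin 4} {p q : Complement} {g : FundamentalGroup Complement base}
    (h : Related i j p g) (hpq : JoinedIn (chart i ∩ chart j) p q) : Related i j q g := by
  obtain ⟨hi, hj, h⟩ := h
  refine ⟨hpq.target_mem.1, hpq.target_mem.2, ?_⟩
  rw [← radial_trans_within hi, ← radial_trans_within hj, h, Quotient.trans_assoc,
    Quotient.within_eq_within _ _ hpq]

theorem related_base (i j : Fin 4) : Related i j base 1 := by
  refine ⟨base_mem i, base_mem j, ?_⟩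
  rw [radial_base, radial_base, FundamentalGroup.one_def, FundamentalGroup.toPath,
    FundamentalGroup.toArrow, Quotient.trans_refl]

theorem Related.trans {i j k : Fin 4} {p : Complement} {g g' : FundamentalGroup Complement base}
    (h : Related i j p g) (h' : Related j k p g') : Related i k p (g' * g) := by
  obtain ⟨hi, hj, h⟩ := h
  obtain ⟨hj, hk, h'⟩ := h'
  refine ⟨hi, hk, ?_⟩
  rw [h, h', ← Quotient.trans_assoc]
  rfl

theorem Related.symm {i j : Fin 4} {p : Complement} {g : FundamentalGroup Complement base}
    (h : Related i j p g) : Related j i p g⁻¹ := by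
  obtain ⟨hi, hj, h⟩ := h
  refine ⟨hj, hi, ?_⟩
  rw [h, FundamentalGroup.inv_def, FundamentalGroup.toPath, ← Quotient.trans_assoc,
    FundamentalGroup.toArrow, Quotient.symm_trans, Quotient.refl_trans]

theorem Related.unique {i j : Fin 4} {p : Complement} {g g' : FundamentalGroup Complement base}
    (h : Related i j p g) (h' : Related i j p g') : g = g' := by
  obtain ⟨hi, hj, h⟩ := h
  obtain ⟨hi, hj, h'⟩ := h'
  have := congrArg (Quotient.trans · (radial j hj).symm) (h.symm.trans h')
  simpa only [Quotient.trans_assoc, Quotient.trans_symm, Quotient.trans_refl] using this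

theorem exists_related {i j : Fin 4} {p : Complement} (hi : p ∈ chart i) (hj : p ∈ chart j) :
    ∃ g, Related i j p g :=
  ⟨FundamentalGroup.fromPath ((radial i hi).trans (radial j hj).symm), hi, hj, by
    simp only [Quotient.trans_assoc, Quotient.symm_trans, Quotient.trans_refl]⟩

/-- The loop crossing the disc bounded by the unknot. -/
noncomputable def diskLoop : FundamentalGroup Complement base :=
  (exists_related (pt_mem (u := ![-1, 1, 1]) (i := 3) (by simp [vec]))
    (pt_mem (i := 0) (by simp [vec]))).choose

theorem related_diskLoop : Related 3 0 (pt ![-1, 1, 1]) diskLoop :=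
  Exists.choose_spec _

/-- The loop running along a projective line in the complement. -/
noncomputable def lineLoop : FundamentalGroup Complement base :=
  (exists_related (pt_mem (u := ![1, -1, -1]) (i := 3) (by simp [vec]))
    (pt_mem (i := 1) (by simp [vec]))).choose

theorem related_lineLoop : Related 3 1 (pt ![1, -1, -1]) lineLoop :=
  Exists.choose_spec _

theorem base_eq : base = pt ![1, 1, 1] :=
  congrArg pt (by ext k; fin_cases k <;> rfl)

theorem related_lineLoop_two : Related 3 2 (pt ![1, -1, -1]) lineLoop := by
  have h := (related_base 1 2).of_joinedIn
    (base_eq ▸ (joinedIn_antipodal (one_ne_zero)).symm)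
  simpa using related_lineLoop.trans h

theorem lineLoop_mul_self : lineLoop * lineLoop = 1 := by
  have h₁ : Related 3 1 (pt ![1, -1, 1]) lineLoop :=
    related_lineLoop.of_joinedIn (joinedIn_pt (by simp [vec]) (by simp [vec]))
  have h₂ : Related 3 2 (pt ![1, -1, 1]) 1 :=
    (related_base 3 2).of_joinedIn (joinedIn_pt (by simp [vec]) (by simp [vec]))
  have h₃ : Related 3 2 (pt ![1, 1, -1]) lineLoop :=
    related_lineLoop_two.of_joinedIn (joinedIn_pt (by simp [vec]) (by simp [vec]))
  have h₄ : Related 3 1 (pt ![1, 1, -1]) 1 :=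
    (related_base 3 1).of_joinedIn (joinedIn_pt (by simp [vec]) (by simp [vec]))
  have h₅ := (h₁.symm.trans h₂).of_joinedIn (by
    simpa using joinedIn_antipodal (s := -1) (by simp))
  have h := h₅.unique (h₄.symm.trans h₃)
  rw [one_mul, inv_one, mul_one] at h
  exact mul_eq_one_iff_inv_eq.2 h

/-- The homomorphism from the cyclic group of order two determined by the line. -/
noncomputable def lineHom : Multiplicative (ZMod 2) →* FundamentalGroup Complement base :=
  AddMonoidHom.toMultiplicativeLeft (ZMod.lift 2
    ⟨MonoidHom.toAdditiveRight (zpowersHom _ lineLoop),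
      congrArg Additive.ofMul ((zpow_two lineLoop).trans lineLoop_mul_self)⟩)

theorem lineHom_ofAdd_one : lineHom (.ofAdd 1) = lineLoop :=
  (congrArg Additive.toMul (ZMod.lift_coe 2 _ 1)).trans (zpow_one lineLoop)

/-- The homomorphism from the free product determined by the two loops. -/
noncomputable def comparison : Monoid.Coprod (Multiplicative ℤ) (Multiplicative (ZMod 2)) →*
    FundamentalGroup Complement base :=
  Monoid.Coprod.lift (zpowersHom _ diskLoop) lineHom

theorem comparison_inl : comparison (.inl (.ofAdd 1)) = diskLoop := by
  simp [comparison]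

theorem comparison_inr : comparison (.inr (.ofAdd 1)) = lineLoop := by
  simp [comparison, lineHom_ofAdd_one]

theorem related_three {u : Fin 3 → ℝ} {i : Fin 4} (hi : vec u i ≠ 0) :
    ∃ g ∈ comparison.range, Related 3 i (pt u) g := by
  obtain h | h := hi.lt_or_gt
  · have key : ∀ (u' : Fin 3 → ℝ), vec u' i = -1 → JoinedIn (chart 3 ∩ chart i) (pt u') (pt u) :=
      fun u' hu' ↦ joinedIn_pt (by simp [vec]) (by rw [hu']; linarith)
    fin_cases i
    · exact ⟨_, ⟨_, comparison_inl⟩, related_diskLoop.of_joinedIn (key _ (by simp [vec]))⟩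
    · exact ⟨_, ⟨_, comparison_inr⟩, related_lineLoop.of_joinedIn (key _ (by simp [vec]))⟩
    · exact ⟨_, ⟨_, comparison_inr⟩, related_lineLoop_two.of_joinedIn (key _ (by simp [vec]))⟩
    · norm_num [vec] at h
  · exact ⟨1, one_mem _, (related_base 3 i).of_joinedIn
      (joinedIn_pt (by simp [vec]) (by rwa [vec_one, one_mul]))⟩

theorem related_pt {u : Fin 3 → ℝ} {i j : Fin 4} (hi : vec u i ≠ 0) (hj : vec u j ≠ 0) :
    ∃ g ∈ comparison.range, Related i j (pt u) g := by
  obtain ⟨g, hg, h⟩ := related_three hi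
  obtain ⟨g', hg', h'⟩ := related_three hj
  exact ⟨_, mul_mem hg' (inv_mem hg), h.symm.trans h'⟩

theorem exists_proj_eq_pt (v : Lift) (h : v.1 3 ≠ 0) :
    ∃ u, proj v = pt u ∧ ∀ i, v.1 i ≠ 0 → vec u i ≠ 0 := by
  have key : v.1 3 • vec ![v.1 0 / v.1 3, v.1 1 / v.1 3, v.1 2 / v.1 3] = v.1 := by
    ext k
    fin_cases k <;> simp [vec, mul_div_cancel₀, h]
  refine ⟨_, proj_eq_iff.2 ⟨_, key⟩, fun i hi h0 ↦ hi ?_⟩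
  rw [← key, PiLp.smul_apply, h0, smul_zero]

theorem exists_related_mem_range {i j : Fin 4} {p : Complement} (hi : p ∈ chart i)
    (hj : p ∈ chart j) : ∃ g ∈ comparison.range, Related i j p g := by
  have lift : ∀ v : Lift, v.1 ∈ cone i → v.1 ∈ cone j → v.1 3 ≠ 0 →
      ∃ g ∈ comparison.range, Related i j (proj v) g := by
    intro v hi hj hv
    obtain ⟨u, hu, h⟩ := exists_proj_eq_pt v hv
    rw [hu]
    exact related_pt (h i hi.1) (h j hj.1)
  by_cases hp : p.1.rep 3 = 0
  · have hmem : ∀ k, p ∈ chart k → ∀ t : ℝ, p.1.rep + t • EuclideanSpace.single 3 1 ∈ cone k := by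
      rintro k ⟨hk, h⟩ t
      have hk3 : k ≠ 3 := by
        rintro rfl
        exact hk hp
      refine ⟨by simpa [hk3] using hk, Or.inr ?_⟩
      simpa [hp] using h
    have hjoin : JoinedIn (cone i ∩ cone j) (p.1.rep + (1 : ℝ) • EuclideanSpace.single 3 1)
        p.1.rep := by
      refine .of_segment_subset ?_
      rintro _ ⟨a, b, -, -, hab, rfl⟩
      have : a • (p.1.rep + (1 : ℝ) • EuclideanSpace.single 3 1) + b • p.1.rep =
          p.1.rep + a • EuclideanSpace.single 3 1 := by
        rw [one_smul, smul_add, add_right_comm, ← add_smul, hab, one_smul]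
      rw [this]
      exact ⟨hmem i hi a, hmem j hj a⟩
    obtain ⟨g, hg, h⟩ := lift ⟨_, i, hjoin.source_mem.1⟩ hjoin.source_mem.1 hjoin.source_mem.2
      (by simp [hp])
    exact ⟨g, hg, proj_repLift p ▸ h.of_joinedIn (joinedIn_charts hjoin)⟩
  · exact proj_repLift p ▸ lift (repLift p) hi hj hp

theorem comparison_surjective : Function.Surjective comparison := by
  have key : ∀ {x y : Complement} (γ : Path.Homotopic.Quotient x y) (i j : Fin 4)
      (hx : x ∈ chart i) (hy : y ∈ chart j), ∃ g ∈ comparison.range,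
        (radial i hx).trans γ = Quotient.trans (FundamentalGroup.toPath g) (radial j hy) := by
    intro x y γ
    refine Quotient.induction_of_openCover isOpen_chart exists_mem_chart
      (P := fun x y γ ↦ ∀ (i j : Fin 4) (hx : x ∈ chart i) (hy : y ∈ chart j),
        ∃ g ∈ comparison.range,
          (radial i hx).trans γ = Quotient.trans (FundamentalGroup.toPath g) (radial j hy))
      ?_ ?_ γ
    · intro k x y γ hγ i j hx hy
      have hγ' : ∀ t, γ t ∈ chart k := fun t ↦ hγ ⟨t, rfl⟩
      have hxk : x ∈ chart k := by simpa using hγ' 0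
      have hyk : y ∈ chart k := by simpa using hγ' 1
      obtain ⟨g, hg, _, _, h⟩ := exists_related_mem_range hx hxk
      obtain ⟨g', hg', _, _, h'⟩ := exists_related_mem_range hyk hy
      refine ⟨g' * g, mul_mem hg' hg, ?_⟩
      rw [h, Quotient.mk_eq_within (isSimplyConnected_chart k) hxk hyk γ hγ',
        Quotient.trans_assoc, radial_trans_within, h', ← Quotient.trans_assoc]
      rfl
    · intro x y z γ δ hγ hδ i j hx hz
      obtain ⟨k, hk⟩ := exists_mem_chart y
      obtain ⟨g, hg, h⟩ := hγ i k hx hk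
      obtain ⟨g', hg', h'⟩ := hδ k j hk hz
      refine ⟨g' * g, mul_mem hg' hg, ?_⟩
      rw [← Quotient.trans_assoc, h, Quotient.trans_assoc, h', ← Quotient.trans_assoc]
      rfl
  intro γ
  obtain ⟨g, ⟨w, rfl⟩, h⟩ := key (FundamentalGroup.toPath γ) 3 3 (base_mem 3) (base_mem 3)
  rw [radial_base, Quotient.refl_trans, Quotient.trans_refl] at h
  exact ⟨w, h.symm⟩

/-- The free product of an infinite cyclic group and a cyclic group of order two. -/
abbrev FreeProduct := Monoid.Coprod (Multiplicative ℤ) (Multiplicative (ZMod 2))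

instance : TopologicalSpace FreeProduct := ⊥

instance : DiscreteTopology FreeProduct := ⟨rfl⟩

/-- The generator of infinite order. -/
noncomputable def freeGen : FreeProduct := .inl (.ofAdd 1)

/-- The generator of order two. -/
noncomputable def torsionGen : FreeProduct := .inr (.ofAdd 1)

theorem torsionGen_mul_self : torsionGen * torsionGen = 1 := by
  rw [torsionGen, ← map_mul, ← ofAdd_add]
  exact map_one _

/-- The coordinate whose sign determines the sheet of a chart. -/
def signIndex (i : Fin 4) : Fin 4 := if i = 0 then 3 else i

/-- The element of the free product determined by the position of a vector with respect to a
chart. -/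
noncomputable def sheet (i : Fin 4) (v : V) : FreeProduct :=
  (if i = 0 ∧ v i * v 3 < 0 then freeGen else 1) * if v (signIndex i) < 0 then torsionGen else 1

theorem sheet_smul {i : Fin 4} {c : ℝ} (hc : c ≠ 0) {v : V} (hv : v (signIndex i) ≠ 0) :
    sheet i (c • v) = sheet i v * if c < 0 then torsionGen else 1 := by
  have h : c * v i * (c * v 3) < 0 ↔ v i * v 3 < 0 := by
    rw [mul_mul_mul_comm, ← pow_two]
    exact ⟨fun h ↦ by nlinarith [sq_nonneg c], mul_neg_of_pos_of_neg (by positivity)⟩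
  simp only [sheet, PiLp.smul_apply, smul_eq_mul, h]
  rw [mul_assoc]
  congr 1
  obtain hc | hc := hc.lt_or_gt
  · obtain hv | hv := hv.lt_or_gt
    · simp [hc, hv, (mul_pos_of_neg_of_neg hc hv).not_gt, torsionGen_mul_self]
    · simp [hc, hv.not_gt, mul_neg_of_neg_of_pos hc hv]
  · simp [hc.not_gt, mul_neg_iff, hc]

theorem signIndex_ne_zero {i j : Fin 4} (hij : i ≠ j) {v : V} (hi : v ∈ cone i)
    (hj : v ∈ cone j) : v (signIndex i) ≠ 0 := by
  unfold signIndex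
  by_cases h : i = 0
  · subst h
    intro h3
    rw [if_pos rfl] at h3
    obtain ⟨-, hi | ⟨-, hi⟩ | ⟨hi, -⟩⟩ := hi
    · exact hi h3
    · obtain ⟨-, hj | ⟨hj, -⟩ | ⟨-, hj⟩⟩ := hj
      exacts [hj h3, hij hj.symm, lt_asymm hi hj]
    · exact hi rfl
  · rw [if_neg h]
    exact hi.1

theorem continuousOn_ite_neg {Y A : Type*} [TopologicalSpace Y] [TopologicalSpace A] {f : Y → ℝ}
    (hf : Continuous f) (x y : A) :
    ContinuousOn (fun v ↦ if f v < 0 then x else y) {v | f v ≠ 0} := by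
  intro v hv
  refine ContinuousAt.continuousWithinAt ?_
  obtain h | h := lt_or_gt_of_ne hv
  · refine (continuousAt_const (y := x)).congr ?_
    filter_upwards [hf.continuousAt.eventually_lt continuousAt_const h] with u hu
    rw [if_pos hu]
  · refine (continuousAt_const (y := y)).congr ?_
    filter_upwards [continuousAt_const.eventually_lt hf.continuousAt h] with u hu
    rw [if_neg hu.not_gt]

theorem continuousOn_sheet {i j : Fin 4} (hij : i ≠ j) :
    ContinuousOn (sheet i) (cone i ∩ cone j) := by
  have h := continuousOn_ite_neg (f := fun v : V ↦ v (signIndex i)) (by fun_prop) torsionGen 1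
  have h' : ContinuousOn (fun v : V ↦ if i = 0 ∧ v i * v 3 < 0 then freeGen else 1)
      (cone i ∩ cone j) := by
    by_cases hi : i = 0
    · simp only [hi, true_and]
      refine (continuousOn_ite_neg (f := fun v : V ↦ v 0 * v 3) (by fun_prop) freeGen 1).mono ?_
      rintro v ⟨hv, hv'⟩
      have := signIndex_ne_zero hij (hi ▸ hv) hv'
      rw [signIndex, if_pos hi] at this
      exact mul_ne_zero hv.1 this
    · simpa only [hi, false_and, if_false] using continuousOn_const
  exact h'.mul (h.mono fun v hv ↦ signIndex_ne_zero hij hv.1 hv.2)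

/-- The transition functions of the covering space associated with the sheets. -/
noncomputable def transition (i j : Fin 4) (p : Complement) : FreeProduct :=
  sheet j p.1.rep * (sheet i p.1.rep)⁻¹

theorem transition_self (i : Fin 4) (p : Complement) : transition i i p = 1 :=
  mul_inv_cancel _

theorem transition_proj {i j : Fin 4} (hij : i ≠ j) {v : Lift} (hi : v.1 ∈ cone i)
    (hj : v.1 ∈ cone j) : transition i j (proj v) = sheet j v.1 * (sheet i v.1)⁻¹ := by
  obtain ⟨c, hc, h⟩ := exists_rep_proj v
  rw [transition, h, sheet_smul hc (signIndex_ne_zero hij hi hj),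
    sheet_smul hc (signIndex_ne_zero hij.symm hj hi)]
  group

theorem continuousOn_transition (i j : Fin 4) :
    ContinuousOn (transition i j) (chart i ∩ chart j) := by
  obtain rfl | hij := eq_or_ne i j
  · simpa only [funext (transition_self i)] using continuousOn_const
  rw [isOpenQuotientMap_proj.isQuotientMap.continuousOn_isOpen_iff
    ((isOpen_chart i).inter (isOpen_chart j))]
  have hmem : ∀ v ∈ proj ⁻¹' (chart i ∩ chart j), v.1 ∈ cone i ∩ cone j := fun v hv ↦
    ⟨proj_mem_chart_iff.1 hv.1, proj_mem_chart_iff.1 hv.2⟩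
  refine ContinuousOn.congr (f := fun v : Lift ↦ sheet j v.1 * (sheet i v.1)⁻¹) ?_ fun v hv ↦
    transition_proj hij (hmem v hv).1 (hmem v hv).2
  refine ContinuousOn.mul ?_ (ContinuousOn.inv ?_)
  · exact (continuousOn_sheet hij.symm).comp continuous_subtype_val.continuousOn
      fun v hv ↦ (hmem v hv).symm
  · exact (continuousOn_sheet hij).comp continuous_subtype_val.continuousOn hmem

/-- The covering space of the complement glued from the charts. -/
noncomputable def coveringCore : FiberBundleCore (Fin 4) Complement FreeProduct where
  baseSet := chart
  isOpen_baseSet := isOpen_chart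
  indexAt p := (exists_mem_chart p).choose
  mem_baseSet_at p := (exists_mem_chart p).choose_spec
  coordChange i j p g := transition i j p * g
  coordChange_self i p _ g := by rw [transition_self, one_mul]
  continuousOn_coordChange i j :=
    ((continuousOn_transition i j).comp continuousOn_fst fun _ h ↦ h.1).mul continuousOn_snd
  coordChange_comp i j k p _ g := by
    simp only [transition]
    group

/-- The coordinate of a point of the fibre over the base point. -/
noncomputable def coord (i : Fin 4) {p : Complement} (e : coveringCore.proj ⁻¹' {p}) :
    FreeProduct :=
  (coveringCore.localTriv i e.1).2

theorem coord_eq {i j : Fin 4} {p : Complement} (hi : p ∈ chart i) (hj : p ∈ chart j)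
    (e : coveringCore.proj ⁻¹' {p}) : coord j e = transition i j p * coord i e := by
  obtain ⟨e, rfl⟩ := e
  exact coveringCore.localTriv_snd_eq e hi hj

theorem transition_base (i j : Fin 4) : transition i j base = 1 := by
  obtain rfl | hij := eq_or_ne i j
  · exact transition_self i base
  rw [base, pt, transition_proj hij (vec_mem_cone (by simp [vec_one]))
    (vec_mem_cone (by simp [vec_one]))]
  have : ∀ k, sheet k (vec 1) = 1 := fun k ↦ by norm_num [sheet, vec_one]
  simp [this]

theorem coord_base (i j : Fin 4) (e : coveringCore.proj ⁻¹' {base}) : coord j e = coord i e := by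
  rw [coord_eq (base_mem i) (base_mem j), transition_base, one_mul]

theorem coord_monodromy_radial {i : Fin 4} {p : Complement} (hp : p ∈ chart i)
    (e : coveringCore.proj ⁻¹' {base}) :
    coord i (coveringCore.isCoveringMap.monodromy (radial i hp) e) = coord i e :=
  coveringCore.localTriv_monodromy_mk i _ (fun t ↦ JoinedIn.somePath_mem _ t) e

theorem Related.coord_monodromy {i j : Fin 4} {p : Complement}
    {g : FundamentalGroup Complement base} (h : Related i j p g)
    (e : coveringCore.proj ⁻¹' {base}) :
    coord 3 (coveringCore.isCoveringMap.monodromy (FundamentalGroup.toPath g) e) =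
      transition i j p * coord 3 e := by
  obtain ⟨hi, hj, h⟩ := h
  rw [coord_base j, ← coord_monodromy_radial hj, ← IsCoveringMap.monodromy_trans_apply, ← h,
    coord_eq hi hj, coord_monodromy_radial, coord_base 3 i]

theorem coord_monodromy_comparison (w : FreeProduct) (e : coveringCore.proj ⁻¹' {base}) :
    coord 3 (coveringCore.isCoveringMap.monodromyPerm base (comparison w) e) = w * coord 3 e := by
  let H : Subgroup FreeProduct := {
    carrier := {w | ∀ e, coord 3 (coveringCore.isCoveringMap.monodromyPerm base (comparison w) e) =
      w * coord 3 e}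
    one_mem' := fun e ↦ by simp only [map_one, Equiv.Perm.one_apply, one_mul]
    mul_mem' := fun {w w'} hw hw' e ↦ by
      rw [map_mul, map_mul, Equiv.Perm.mul_apply, hw, hw', mul_assoc]
    inv_mem' := fun {w} hw e ↦ by
      rw [eq_inv_mul_iff_mul_eq, ← hw, ← Equiv.Perm.mul_apply, ← map_mul, ← map_mul, mul_inv_cancel,
        map_one, map_one, Equiv.Perm.one_apply] }
  have hfree : freeGen ∈ H := fun e ↦ by
    rw [freeGen, comparison_inl]
    refine (related_diskLoop.coord_monodromy e).trans ?_
    rw [pt, transition_proj (by decide) (vec_mem_cone (by simp [vec]))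
      (vec_mem_cone (by simp [vec]))]
    simp [sheet, signIndex, vec, (zero_lt_one (α := ℝ)).not_gt, freeGen]
  have htorsion : torsionGen ∈ H := fun e ↦ by
    rw [torsionGen, comparison_inr]
    refine (related_lineLoop.coord_monodromy e).trans ?_
    rw [pt, transition_proj (by decide) (vec_mem_cone (by simp [vec]))
      (vec_mem_cone (by simp [vec]))]
    simp [sheet, signIndex, vec, (zero_lt_one (α := ℝ)).not_gt, torsionGen]
  have hH : w ∈ H := by
    induction w using Monoid.Coprod.induction_on with
    | inl m =>
      have : (.inl m : FreeProduct) = freeGen ^ m.toAdd := by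
        rw [freeGen, ← map_zpow, ← ofAdd_zsmul, smul_eq_mul, mul_one, ofAdd_toAdd]
      rw [this]
      exact zpow_mem hfree _
    | inr m =>
      induction m using Multiplicative.rec with | ofAdd m =>
      fin_cases m
      · exact (map_one (Monoid.Coprod.inr : _ →* FreeProduct)).symm ▸ one_mem H
      · exact htorsion
    | mul w w' hw hw' => exact mul_mem hw hw'
  exact hH e

theorem comparison_injective : Function.Injective comparison := by
  rw [injective_iff_map_eq_one]
  intro w hw
  have h := coord_monodromy_comparison w ⟨⟨base, (1 : FreeProduct)⟩, rfl⟩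
  rwa [hw, map_one, Equiv.Perm.one_apply, right_eq_mul] at h

theorem pathConnectedSpace_complement : PathConnectedSpace Complement where
  nonempty := ⟨base⟩
  joined p q := by
    obtain ⟨i, hi⟩ := exists_mem_chart p
    obtain ⟨j, hj⟩ := exists_mem_chart q
    exact ((isSimplyConnected_chart i).isPathConnected.joinedIn _ hi _ (base_mem i)).joined.trans
      ((isSimplyConnected_chart j).isPathConnected.joinedIn _ (base_mem j) _ hj).joined

theorem unknot_eq : unknot = {z | ∃ (θ : ℝ) (hv : (!₂[1, Real.cos θ, Real.sin θ, 0] : V) ≠ 0),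
    Projectivization.mk ℝ (!₂[1, Real.cos θ, Real.sin θ, 0] : V) hv = z} := by
  ext z
  constructor
  · intro hz
    have hz0 := z.rep_nonzero
    have h3 : z.rep 3 = 0 := by
      by_contra h
      exact hz 3 ⟨h, .inl h⟩
    have hc : z.rep 1 ^ 2 + z.rep 2 ^ 2 = z.rep 0 ^ 2 := by
      refine le_antisymm (not_lt.1 fun h ↦ ?_) (not_lt.1 fun h ↦ ?_)
      · by_cases h1 : z.rep 1 = 0
        · have h2 : z.rep 2 ≠ 0 := fun h2 ↦ by nlinarith [sq_nonneg (z.rep 0)]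
          exact hz 2 ⟨h2, .inr (.inr ⟨by decide, h⟩)⟩
        · exact hz 1 ⟨h1, .inr (.inr ⟨by decide, h⟩)⟩
      · have h0 : z.rep 0 ≠ 0 := fun h0 ↦ by nlinarith [sq_nonneg (z.rep 1), sq_nonneg (z.rep 2)]
        exact hz 0 ⟨h0, .inr (.inl ⟨rfl, h⟩)⟩
    have h0 : z.rep 0 ≠ 0 := fun h0 ↦ hz0 (by
      have h1 : z.rep 1 = 0 := by nlinarith [sq_nonneg (z.rep 1), sq_nonneg (z.rep 2)]
      have h2 : z.rep 2 = 0 := by nlinarith [sq_nonneg (z.rep 1), sq_nonneg (z.rep 2)]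
      ext k
      fin_cases k <;> simpa)
    let w : ℂ := ⟨z.rep 1 / z.rep 0, z.rep 2 / z.rep 0⟩
    have hw : ‖w‖ = 1 := by
      rw [Complex.norm_eq_sqrt_sq_add_sq, Real.sqrt_eq_one]
      simp only [w]
      field_simp
      exact hc
    refine ⟨w.arg, fun h ↦ by simpa using congrArg (· 0) h, ?_⟩
    rw [← z.mk_rep, Projectivization.mk_eq_mk_iff']
    refine ⟨(z.rep 0)⁻¹, ?_⟩
    have hw0 : w ≠ 0 := norm_ne_zero_iff.1 (by rw [hw]; exact one_ne_zero)
    rw [Complex.cos_arg hw0, Complex.sin_arg, hw]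
    ext k
    fin_cases k <;> simp [h0, h3, w, div_eq_inv_mul]
  · rintro ⟨θ, hv, rfl⟩ i
    rw [rep_mk_mem_cone_iff]
    rintro ⟨hi, h⟩
    fin_cases i <;> simp [Real.cos_sq_add_sin_sq] at hi h

end AffineUnknot

/-- Theorem 1 of the paper, "only if" direction for the standard affine unknot: the
fundamental group of the complement in `ℝP³` of the round affine circle
`θ ↦ [1 : cos θ : sin θ : 0]` is the free product `ℤ ∗ (ℤ/2ℤ)`. -/
theorem fundamentalGroup_complement_affine_unknot
    (C : Set (Projectivization ℝ (EuclideanSpace ℝ (Fin 4))))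
    (hC : C = {z | ∃ (θ : ℝ)
      (hv : (!₂[1, Real.cos θ, Real.sin θ, 0] : EuclideanSpace ℝ (Fin 4)) ≠ 0),
      Projectivization.mk ℝ (!₂[1, Real.cos θ, Real.sin θ, 0] : EuclideanSpace ℝ (Fin 4)) hv = z})
    (x₀ : {z : Projectivization ℝ (EuclideanSpace ℝ (Fin 4)) // z ∉ C}) :
    Nonempty (FundamentalGroup {z : Projectivization ℝ (EuclideanSpace ℝ (Fin 4)) // z ∉ C} x₀
      ≃* Monoid.Coprod (Multiplicative ℤ) (Multiplicative (ZMod 2))) := by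
  obtain rfl : C = AffineUnknot.unknot := hC.trans AffineUnknot.unknot_eq.symm
  have := AffineUnknot.pathConnectedSpace_complement
  exact ⟨(FundamentalGroup.fundamentalGroupMulEquivOfPathConnected x₀ AffineUnknot.base).trans
    (MulEquiv.ofBijective AffineUnknot.comparison
      ⟨AffineUnknot.comparison_injective, AffineUnknot.comparison_surjective⟩).symm⟩
end

section
/- Let W be a 3-dimensional linear subspace of EuclideanSpace ℝ (Fin 4) and let H ⊂ ℝP³ be the corresponding projective plane (the image under Projectivization.mk of the nonzero vectors of W). Let L be a closed subset of ℝP³ with L ∩ H = ∅. Then for every basepoint x₀ ∈ H, the fundamental group π₁(ℝP³ \ L, x₀) contains a non-trivial element of order 2, i.e. there exists g ∈ π₁(ℝP³ \ L, x₀) with g ≠ 1 and g² = 1. -/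
open unitInterval in
/-- A loop which lifts to a non-closed path along a covering map is not null-homotopic. -/
theorem IsCoveringMap.not_homotopic_refl_of_lift {E X : Type*} [TopologicalSpace E]
    [TopologicalSpace X] {p : E → X} (hp : IsCoveringMap p) {a b : E} (hab : a ≠ b)
    (Γ : Path a b) {x : X} (δ : Path x x) (hδ : ∀ t, p (Γ t) = δ t) :
    ¬ δ.Homotopic (Path.refl x) := by
  intro h
  have ha : p a = x := by simpa using hδ 0
  have key := hp.liftPath_apply_one_eq_of_homotopicRel h a
    (by simp [ha]) (by simp [ha])
  have h₁ : Γ.toContinuousMap = hp.liftPath δ.toContinuousMap a (by simp [ha]) :=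
    (hp.eq_liftPath_iff' _).2 ⟨funext hδ, Γ.source⟩
  have h₂ : ContinuousMap.const I a
      = hp.liftPath (Path.refl x).toContinuousMap a (by simp [ha]) :=
    (hp.eq_liftPath_iff' _).2 ⟨funext fun _ => ha, rfl⟩
  rw [← h₁, ← h₂] at key
  exact hab (by simpa using key.symm)

/-- The unit sphere of the real numbers is finite. -/
theorem finite_sphere_real : Finite (Metric.sphere (0 : ℝ) 1) := by
  refine Set.Finite.to_subtype (Set.Finite.subset (Set.toFinite {1, -1}) fun x hx => ?_)
  have : |x| = 1 := by simpa using hx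
  simpa using eq_or_eq_neg_of_abs_eq this

open Topology in
/-- The double cover of a real projective space by the unit sphere is a covering map. -/
theorem Projectivization.isCoveringMap_mk_sphere {V : Type*} [NormedAddCommGroup V]
    [NormedSpace ℝ V] [FiniteDimensional ℝ V] :
    IsCoveringMap fun v : Metric.sphere (0 : V) 1 =>
      Projectivization.mk ℝ (v : V) (ne_zero_of_mem_unit_sphere v) := by
  have hmk : IsQuotientMap fun v : {v : V // v ≠ 0} => Projectivization.mk ℝ v.1 v.2 :=
    isQuotientMap_quotient_mk'
  have hnorm (v : {v : V // v ≠ 0}) : ‖v.1‖⁻¹ • v.1 ∈ Metric.sphere (0 : V) 1 := by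
    simp [norm_smul, v.2]
  have hq : IsQuotientMap fun v : Metric.sphere (0 : V) 1 =>
      Projectivization.mk ℝ (v : V) (ne_zero_of_mem_unit_sphere v) := by
    refine IsQuotientMap.of_comp (f := fun v : {v : V // v ≠ 0} =>
        (⟨‖v.1‖⁻¹ • v.1, hnorm v⟩ : Metric.sphere (0 : V) 1)) ?_ ?_ ?_
    · refine Continuous.subtype_mk (Continuous.smul (Continuous.inv₀ (by fun_prop) ?_)
        (by fun_prop)) _
      simp
    · exact hmk.continuous.comp (f := fun v : Metric.sphere (0 : V) 1 =>
        (⟨v, ne_zero_of_mem_unit_sphere v⟩ : {v : V // v ≠ 0})) (by fun_prop)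
    · convert hmk using 1
      funext v
      exact (Projectivization.mk_eq_mk_iff' ℝ _ _ _ _).2 ⟨‖v.1‖⁻¹, rfl⟩
  have := finite_sphere_real
  have : LocallyCompactSpace (Metric.sphere (0 : V) 1) :=
    Metric.isClosed_sphere.isClosedEmbedding_subtypeVal.locallyCompactSpace
  have : IsCancelSMul (Metric.sphere (0 : ℝ) 1) (Metric.sphere (0 : V) 1) := by
    refine (isCancelSMul_iff_eq_one_of_smul_eq (α := Metric.sphere (0 : ℝ) 1)
      (β := Metric.sphere (0 : V) 1)).2 fun g e h => ?_
    have h' : (g : ℝ) • (e : V) = (1 : ℝ) • (e : V) := by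
      rw [one_smul]; exact congrArg Subtype.val h
    exact Subtype.ext (smul_left_injective ℝ (ne_zero_of_mem_unit_sphere e) h')
  refine (hq.isQuotientCoveringMap_of_properlyDiscontinuousSMul
    (G := Metric.sphere (0 : ℝ) 1) fun {e₁ e₂} => ?_).isCoveringMap
  refine (Projectivization.mk_eq_mk_iff' ℝ _ _ _ _).trans ⟨?_, ?_⟩
  · rintro ⟨a, ha⟩
    refine ⟨⟨a, ?_⟩, Subtype.ext ha⟩
    simpa [norm_smul] using congrArg norm ha
  · rintro ⟨g, hg⟩
    exact ⟨g, congrArg Subtype.val hg⟩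

/-- A non-trivial combination of three linearly independent vectors is non-zero. -/
theorem LinearIndependent.sum_three_ne_zero {R V : Type*} [Ring R] [AddCommGroup V] [Module R V]
    {b : Fin 3 → V} (hb : LinearIndependent R b) {x y z : R} (h : ¬ (x = 0 ∧ y = 0 ∧ z = 0)) :
    x • b 0 + y • b 1 + z • b 2 ≠ 0 := by
  intro h0
  have := Fintype.linearIndependent_iff.1 hb ![x, y, z] (by simpa [Fin.sum_univ_three] using h0)
  exact h ⟨this 0, this 1, this 2⟩

/-- The straight-line contraction of the unit circle to the point `(1, 0)`, pushed into a third
dimension, avoids the origin. -/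
theorem circle_contraction_ne_zero (s θ : ℝ) :
    ¬ ((1 - s) * Real.cos θ + s = 0 ∧ (1 - s) * Real.sin θ = 0 ∧
      s * (1 - s) * (1 - Real.cos θ) = 0) := by
  rintro ⟨h₁, h₂, h₃⟩
  have hs := Real.sin_sq_add_cos_sq θ
  rcases mul_eq_zero.1 h₂ with h | h
  · rw [h] at h₁; linarith
  · rcases mul_eq_zero.1 h₃ with h' | h'
    · rcases mul_eq_zero.1 h' with h'' | h''
      · subst h''; simp at h₁; rw [h, h₁] at hs; norm_num at hs
      · rw [h''] at h₁; linarith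
    · have : Real.cos θ = 1 := by linarith
      rw [this] at h₁; linarith

open unitInterval in
/-- Under an even map on the non-zero vectors of a space containing three independent vectors,
a half circle becomes a loop whose square is null-homotopic. -/
theorem exists_half_circle_loop {V Y : Type*} [AddCommGroup V] [Module ℝ V] [TopologicalSpace V]
    [ContinuousAdd V] [ContinuousSMul ℝ V] [TopologicalSpace Y] (f : C({v : V // v ≠ 0}, Y))
    (hf : ∀ v w : {v : V // v ≠ 0}, w.1 = -v.1 → f w = f v)
    {b : Fin 3 → V} (hb : LinearIndependent ℝ b) :
    ∃ δ : Path (f ⟨b 0, hb.ne_zero 0⟩) (f ⟨b 0, hb.ne_zero 0⟩),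
      (∀ t : I, ∃ h, δ t =
        f ⟨Real.cos (Real.pi * t) • b 0 + Real.sin (Real.pi * t) • b 1, h⟩) ∧
      (δ.trans δ).Homotopic (Path.refl _) := by
  have hne (θ : ℝ) : Real.cos θ • b 0 + Real.sin θ • b 1 ≠ 0 := by
    simpa using hb.sum_three_ne_zero (circle_contraction_ne_zero 0 θ)
  have hF (s θ : ℝ) := hb.sum_three_ne_zero (circle_contraction_ne_zero s θ)
  let δ : Path (f ⟨b 0, hb.ne_zero 0⟩) (f ⟨b 0, hb.ne_zero 0⟩) :=
    { toFun := fun t => f ⟨_, hne (Real.pi * t)⟩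
      continuous_toFun := f.continuous.comp (Continuous.subtype_mk (by fun_prop) _)
      source' := by simp
      target' := hf _ _ (by simp) }
  have hsq (t : I) : (δ.trans δ) t = f ⟨_, hne (2 * Real.pi * t)⟩ := by
    rw [Path.trans_apply]
    split_ifs with h
    · refine congrArg f (Subtype.ext ?_)
      simp only [show Real.pi * (2 * (t : ℝ)) = 2 * Real.pi * t by ring]
    · refine (hf _ _ ?_).symm
      simp only [show Real.pi * (2 * (t : ℝ) - 1) = 2 * Real.pi * t - Real.pi by ring,
        Real.cos_sub_pi, Real.sin_sub_pi]
      module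
  refine ⟨δ, fun t => ⟨hne _, rfl⟩, ⟨⟨⟨⟨fun p => f ⟨_, hF p.1 (2 * Real.pi * p.2)⟩, ?_⟩,
    fun t => ?_, fun t => ?_⟩, ?_⟩⟩⟩
  · exact f.continuous.comp (Continuous.subtype_mk (by fun_prop) _)
  · refine Eq.trans ?_ (hsq t).symm
    exact congrArg f (Subtype.ext (by simp))
  · exact congrArg f (Subtype.ext (by simp))
  · rintro s t (rfl | rfl)
    · refine Eq.trans ?_ (hsq 0).symm
      exact congrArg f (Subtype.ext (by simp))
    · refine Eq.trans ?_ (hsq 1).symm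
      exact congrArg f (Subtype.ext (by simp))

/-- Necessity direction of Theorem 3 of the paper: if a closed set `L ⊂ ℝP³` is disjoint
from a projective plane `H`, then the fundamental group of `ℝP³ \ L` (based at any point
of `H`) contains a non-trivial element of order two. -/
theorem fundamentalGroup_complement_has_order_two_of_disjoint_from_plane
    (W : Submodule ℝ (EuclideanSpace ℝ (Fin 4))) (hW : Module.finrank ℝ W = 3)
    (H : Set (Projectivization ℝ (EuclideanSpace ℝ (Fin 4))))
    (hH : H = {z | ∃ (v : EuclideanSpace ℝ (Fin 4)) (hv : v ≠ 0),
      v ∈ W ∧ Projectivization.mk ℝ v hv = z})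
    (L : Set (Projectivization ℝ (EuclideanSpace ℝ (Fin 4))))
    (hL : IsClosed L) (hdisj : L ∩ H = ∅)
    (x₀ : Projectivization ℝ (EuclideanSpace ℝ (Fin 4))) (hx₀ : x₀ ∈ H) :
    ∃ g : FundamentalGroup {z : Projectivization ℝ (EuclideanSpace ℝ (Fin 4)) // z ∉ L}
        ⟨x₀, fun hmem => Set.eq_empty_iff_forall_notMem.mp hdisj x₀ ⟨hmem, hx₀⟩⟩,
      g ≠ 1 ∧ g ^ 2 = 1 := by
  have hx₀' := hx₀
  rw [hH] at hx₀'
  obtain ⟨v, hv, hvW, hvx⟩ := hx₀'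
  obtain ⟨b, hb⟩ := Orthonormal.exists_orthonormalBasis_extension_of_card_eq (𝕜 := ℝ) (E := W)
    (ι := Fin 3) (by simpa using hW) (v := fun _ => (⟨‖v‖⁻¹ • v, W.smul_mem _ hvW⟩ : W)) (s := {0})
    (by
      refine ⟨fun i => ?_, fun i j hij => absurd (Subsingleton.elim i j) hij⟩
      simp [Submodule.coe_norm, norm_smul, hv])
  have hb0 : ((b 0 : W) : EuclideanSpace ℝ (Fin 4)) = ‖v‖⁻¹ • v := by
    rw [hb 0 rfl]
  have hlin := b.orthonormal.linearIndependent
  have hne (w : {w : W // w ≠ 0}) : ((w : W) : EuclideanSpace ℝ (Fin 4)) ≠ 0 := by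
    simpa using w.2
  obtain rfl : Projectivization.mk ℝ ((b 0 : W) : EuclideanSpace ℝ (Fin 4))
      (hne ⟨b 0, hlin.ne_zero 0⟩) = x₀ := by
    rw [← hvx, Projectivization.mk_eq_mk_iff']
    exact ⟨‖v‖⁻¹, hb0.symm⟩
  have hcont' : Continuous fun v : {v : EuclideanSpace ℝ (Fin 4) // v ≠ 0} =>
      Projectivization.mk ℝ v.1 v.2 := continuous_quotient_mk'
  have hcont : Continuous fun w : {w : W // w ≠ 0} => Projectivization.mk ℝ _ (hne w) :=
    hcont'.comp (f := fun w : {w : W // w ≠ 0} =>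
      (⟨w.1.1, hne w⟩ : {v : EuclideanSpace ℝ (Fin 4) // v ≠ 0})) (by fun_prop)
  have hmem (w : {w : W // w ≠ 0}) : Projectivization.mk ℝ _ (hne w) ∉ L := fun hw =>
    Set.eq_empty_iff_forall_notMem.mp hdisj _ ⟨hw, hH ▸ ⟨_, hne w, w.1.2, rfl⟩⟩
  obtain ⟨δ, hδ, hδ₂⟩ := exists_half_circle_loop
    (⟨fun w => ⟨_, hmem w⟩, hcont.subtype_mk _⟩ :
      C({w : W // w ≠ 0}, {z : Projectivization ℝ (EuclideanSpace ℝ (Fin 4)) // z ∉ L}))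
    (fun w w' h => Subtype.ext <| (Projectivization.mk_eq_mk_iff' ℝ _ _ _ _).2
      ⟨-1, by rw [h]; simp⟩) hlin
  refine ⟨FundamentalGroup.fromPath (.mk δ), fun h => ?_, ?_⟩
  · have hnull : δ.Homotopic (Path.refl _) := Path.Homotopic.Quotient.exact h
    have horth : inner ℝ ((b 0 : W) : EuclideanSpace ℝ (Fin 4)) (b 1 : W) = 0 :=
      b.orthonormal.2 (by decide)
    have hsphere (θ : ℝ) : ((Real.cos θ • b 0 + Real.sin θ • b 1 : W) :
        EuclideanSpace ℝ (Fin 4)) ∈ Metric.sphere 0 1 := by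
      rw [mem_sphere_zero_iff_norm, ← Submodule.coe_norm, ← sq_eq_sq₀ (norm_nonneg _) zero_le_one,
        norm_add_sq_real]
      simp [norm_smul, inner_smul_left, inner_smul_right, horth]
    refine Projectivization.isCoveringMap_mk_sphere.not_homotopic_refl_of_lift
      (a := ⟨_, hsphere 0⟩) (b := ⟨_, hsphere Real.pi⟩) ?_
      { toFun := fun t => ⟨_, hsphere (Real.pi * t)⟩
        continuous_toFun := Continuous.subtype_mk (by fun_prop) _
        source' := by simp
        target' := by simp }
      (δ.map continuous_subtype_val) (fun t => ?_) (hnull.map ⟨_, continuous_subtype_val⟩)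
    · intro h'
      have h'' := congrArg Subtype.val h'
      simp only [Real.cos_zero, Real.sin_zero, Real.cos_pi, Real.sin_pi, zero_smul, add_zero,
        one_smul, neg_smul, NegMemClass.coe_neg] at h''
      have := IsAddTorsionFree.of_isTorsionFree ℝ (EuclideanSpace ℝ (Fin 4))
      exact hne ⟨b 0, hlin.ne_zero 0⟩ (self_eq_neg.1 h'')
    · obtain ⟨_, ht⟩ := hδ t
      exact (congrArg Subtype.val ht).symm
  · rw [pow_two]
    exact Path.Homotopic.Quotient.eq.2 hδ₂
end
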